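/- arXiv:1506.06186 — 5 statements merged into one kernel-verified Lean document; each statement's English description precedes it below -/
import Mathlib

section
/- Let s and t be coprime positive integers with s, t ≥ 2. Then there exists a unique simultaneous (s,t)-core partition κ such that the Young diagram of every simultaneous (s,t)-core is contained in the Young diagram of κ, and the size of κ equals (s² − 1)(t² − 1)/24. -/
/-- The hook length of the cell `(i, j)` (0-indexed) of a Young diagram. -/
def YoungDiagram.hookLength (Y : YoungDiagram) (i j : ℕ) : ℕ :=
  Y.rowLen i - j + (Y.colLen j - i) - 1

/-- A Young diagram (partition) is a `t`-core if no cell has hook length `t`. -/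
def YoungDiagram.IsCore (Y : YoungDiagram) (t : ℕ) : Prop :=
  ∀ c ∈ Y.cells, Y.hookLength c.1 c.2 ≠ t

theorem sum_ite_count {M : Type*} [AddCommMonoid M] (q : ℕ → Prop) [DecidablePred q] (f : ℕ → M)
    (n : ℕ) :
    ∑ k ∈ Finset.range n, (if q k then f (Nat.count q k) else 0) =
      ∑ r ∈ Finset.range (Nat.count q n), f r := by
  induction n with
  | zero => simp
  | succ n ih =>
    rw [Finset.sum_range_succ, ih, Nat.count_succ]
    split_ifs
    · rw [Finset.sum_range_succ]
    · simp

theorem sum_range_add_of_periodic (s : ℕ) (a : ℕ → ℤ) (hper : ∀ k, a (k + s) = a k) (f : ℤ → ℕ)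
    (d : ℕ) : ∑ k ∈ Finset.range s, f (a (k + d)) = ∑ k ∈ Finset.range s, f (a k) := by
  induction d with
  | zero => simp
  | succ d ih =>
    rw [← ih]
    have h1 := Finset.sum_range_succ (fun k => f (a (k + d))) s
    have h2 := Finset.sum_range_succ' (fun k => f (a (k + d))) s
    have h3 : a (s + d) = a (0 + d) := by rw [add_comm s d, hper, zero_add]
    have h4 : ∑ k ∈ Finset.range s, f (a (k + (d + 1))) =
        ∑ k ∈ Finset.range s, f (a (k + 1 + d)) :=
      Finset.sum_congr rfl fun k _ => by rw [add_right_comm, add_assoc]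
    rw [h4]
    simp only [h3] at h1
    omega

/-- A sequence with upward steps at most `t` that starts at a value at least `s` takes, at its
entries that are at least `s`, values bounded by an arithmetic progression of difference `t`. -/
theorem le_add_count_mul (s t n : ℕ) (c : ℕ → ℤ) (h0 : (s : ℤ) ≤ c 0)
    (hstep : ∀ k, k + 1 < n → c (k + 1) ≤ c k + t) (k : ℕ) (hk : k < n) (hc : (s : ℤ) ≤ c k) :
    c k ≤ c 0 + (Nat.count (fun k => (s : ℤ) ≤ c k) k : ℕ) * t := by
  induction k with
  | zero => simp
  | succ k ih =>
    have hs := hstep k hk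
    by_cases hp : (s : ℤ) ≤ c k
    · have := ih (by omega) hp
      rw [Nat.count_succ, if_pos hp]
      push_cast
      linarith
    · have h1 : 1 ≤ Nat.count (fun k => (s : ℤ) ≤ c k) (k + 1) := by
        have := Nat.count_monotone (fun k => (s : ℤ) ≤ c k) (show 1 ≤ k + 1 by omega)
        rwa [Nat.count_one, if_pos h0] at this
      have h2 : (1 : ℤ) ≤ (Nat.count (fun k => (s : ℤ) ≤ c k) (k + 1) : ℕ) := by exact_mod_cast h1
      have h3 : (0 : ℤ) ≤ t := by positivity
      nlinarith

theorem sum_toNat_ediv_le (s t n : ℕ) (hs : 0 < s) (c : ℕ → ℤ) (h0 : (s : ℤ) ≤ c 0)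
    (hstep : ∀ k, k + 1 < n → c (k + 1) ≤ c k + t) :
    ∑ k ∈ Finset.range n, (c k / s).toNat ≤
      ∑ r ∈ Finset.range (Nat.count (fun k => (s : ℤ) ≤ c k) n), ((c 0 + r * t) / s).toNat := by
  rw [← sum_ite_count (fun k => (s : ℤ) ≤ c k) (fun r => ((c 0 + r * t) / s).toNat)]
  refine Finset.sum_le_sum fun k hk => ?_
  have hs' : (0 : ℤ) < s := by exact_mod_cast hs
  split_ifs with h
  · exact Int.toNat_le_toNat
      (Int.ediv_le_ediv hs' (le_add_count_mul s t n c h0 hstep k (Finset.mem_range.1 hk) h))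
  · have : c k / s < 1 := Int.ediv_lt_of_lt_mul hs' (by linarith)
    omega

theorem exists_shift_of_aligned (s t : ℕ) (a : ℕ → ℤ) (hper : ∀ k, a (k + s) = a k)
    (hstep : ∀ k, a (k + 1) ≤ a k + t) (h0 : (s : ℤ) ≤ a 0) (e : ℕ) (hes : e < s)
    (hae : a e < 0) (hlast : ∀ k, e < k → k < s → 0 ≤ a k ∧ a k < s) :
    ∃ m : ℕ, ∑ k ∈ Finset.range s, (a k / s).toNat ≤
        ∑ k ∈ Finset.range s, (((k : ℤ) * t - m) / s).toNat ∧
      ∑ k ∈ Finset.range s, (-(a k / s)).toNat ≤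
        ∑ k ∈ Finset.range s, (-(((k : ℤ) * t - m) / s)).toNat := by
  have hs : 0 < s := by omega
  have hs' : (0 : ℤ) < s := by exact_mod_cast hs
  have ht : (0 : ℤ) ≤ t := by positivity
  have hneg (x : ℤ) : (s - 1 - x) / s = -(x / s) := by
    have h1 := Int.mul_ediv_add_emod x s
    have h2 := Int.emod_nonneg x hs'.ne'
    have h3 := Int.emod_lt_of_pos x hs'
    have : s - 1 - x = (s - 1 - x % s) + s * (-(x / s)) := by linarith
    rw [this, Int.add_mul_ediv_left _ _ hs'.ne', Int.ediv_eq_zero_of_lt (by linarith) (by linarith)]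
    simp
  set c : ℕ → ℤ := fun k => s - 1 - a (e - k) with hc
  set X := Nat.count (fun k => (s : ℤ) ≤ a k) (e + 1) with hX
  set Y := Nat.count (fun k => (s : ℤ) ≤ c k) (e + 1) with hY
  have htrunc (g : ℤ → ℕ) (hg : ∀ x : ℤ, 0 ≤ x → x < s → g x = 0) :
      ∑ k ∈ Finset.range s, g (a k) = ∑ k ∈ Finset.range (e + 1), g (a k) := by
    refine (Finset.sum_subset (Finset.range_subset_range.2 (by omega)) fun k hk hk' => ?_).symm
    simp only [Finset.mem_range] at hk hk'
    obtain ⟨h1, h2⟩ := hlast k (by omega) hk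
    exact hg _ h1 h2
  have hXY : X + Y ≤ e + 1 := by
    rw [hX, hY, Nat.count_eq_card_filter_range, Nat.count_eq_card_filter_range,
      Finset.card_filter, Finset.card_filter]
    rw [← Finset.sum_range_reflect (fun k => if (s : ℤ) ≤ c k then 1 else 0),
      ← Finset.sum_add_distrib]
    calc _ ≤ ∑ k ∈ Finset.range (e + 1), 1 := Finset.sum_le_sum fun k hk => ?_
      _ = _ := by simp
    have hk' := Finset.mem_range.1 hk
    have : e - (e + 1 - 1 - k) = k := by omega
    simp only [hc, this]
    split_ifs <;> omega
  have hY1 : 1 ≤ Y := by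
    have := Nat.count_monotone (fun k => (s : ℤ) ≤ c k) (show 1 ≤ e + 1 by omega)
    rwa [Nat.count_one, if_pos (by simp only [hc]; simp; omega)] at this
  have hwrap : a 0 ≤ a e + (s - e : ℕ) * t := by
    have h : ∀ d, a (e + d) ≤ a e + d * t := by
      intro d
      induction d with
      | zero => simp
      | succ d ih =>
        have := hstep (e + d)
        push_cast
        rw [← add_assoc]
        linarith
    have := h (s - e)
    rwa [show e + (s - e) = 0 + s by omega, hper] at this
  obtain ⟨m, hm⟩ : ∃ m : ℕ, (m : ℤ) = -a e + (Y - 1) * t :=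
    ⟨(-a e + (Y - 1) * t).toNat, Int.toNat_of_nonneg (by
      have : (0 : ℤ) ≤ Y - 1 := by omega
      have := mul_nonneg this ht
      linarith)⟩
  refine ⟨m, ?_, ?_⟩
  · rw [htrunc (fun x => (x / s).toNat) fun x h1 h2 => by simp [Int.ediv_eq_zero_of_lt h1 h2]]
    refine (sum_toNat_ediv_le s t (e + 1) hs a h0 fun k _ => hstep k).trans ?_
    rw [← hX]
    calc _ ≤ ∑ r ∈ Finset.range X, ((((s - X + r : ℕ) : ℤ) * t - m) / s).toNat :=
          Finset.sum_le_sum fun r _ => Int.toNat_le_toNat (Int.ediv_le_ediv hs' ?_)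
      _ ≤ _ := by
        have := Finset.sum_range_add (fun k => (((k : ℤ) * t - m) / s).toNat) (s - X) X
        rw [show s - X + X = s by omega] at this
        rw [this]
        exact Nat.le_add_left _ _
    have h1 : ((s - e : ℕ) : ℤ) ≤ (s - X : ℕ) - (Y - 1) := by omega
    have h2 := mul_le_mul_of_nonneg_right h1 ht
    push_cast at h2 ⊢
    rw [hm]
    linarith
  · rw [htrunc (fun x => (-(x / s)).toNat) fun x h1 h2 => by simp [Int.ediv_eq_zero_of_lt h1 h2]]
    have hA := sum_toNat_ediv_le s t (e + 1) hs c (by simp only [hc]; simp; omega) (by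
      intro k hk
      simp only [hc]
      have := hstep (e - (k + 1))
      rw [show e - (k + 1) + 1 = e - k by omega] at this
      linarith)
    rw [← hY, ← Finset.sum_range_reflect, ← Finset.sum_range_reflect _ Y] at hA
    calc _ = ∑ k ∈ Finset.range (e + 1), (c (e + 1 - 1 - k) / s).toNat :=
          Finset.sum_congr rfl fun k hk => by
            have hk' := Finset.mem_range.1 hk
            have : e - (e + 1 - 1 - k) = k := by omega
            simp only [hc, this, hneg]
      _ ≤ _ := hA
      _ = ∑ k ∈ Finset.range Y, (-(((k : ℤ) * t - m) / s)).toNat :=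
          Finset.sum_congr rfl fun k hk => by
            have hk' := Finset.mem_range.1 hk
            have : ((Y - 1 - k : ℕ) : ℤ) = Y - 1 - k := by omega
            rw [← hneg, hm, this]
            congr 2
            simp only [hc, Nat.sub_zero]
            ring
      _ ≤ _ := Finset.sum_le_sum_of_subset (Finset.range_subset_range.2 (by omega))

/-- Among the runners of any periodic system with upward steps at most `t`, the numbers of
beads above and of spaces below the origin are dominated, after a suitable translation, by those
of the arithmetic progression of difference `t`. -/
theorem exists_shift (s t : ℕ) (a : ℕ → ℤ) (hper : ∀ k, a (k + s) = a k)
    (hstep : ∀ k, a (k + 1) ≤ a k + t) (hpos : ∃ k, (s : ℤ) ≤ a k) (hneg : ∃ k, a k < 0)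
    (hs : 0 < s) :
    ∃ m : ℕ, ∑ k ∈ Finset.range s, (a k / s).toNat ≤
        ∑ k ∈ Finset.range s, (((k : ℤ) * t - m) / s).toNat ∧
      ∑ k ∈ Finset.range s, (-(a k / s)).toNat ≤
        ∑ k ∈ Finset.range s, (-(((k : ℤ) * t - m) / s)).toNat := by
  classical
  obtain ⟨n, hn⟩ := hneg
  obtain ⟨p, hp⟩ := hpos
  have hmul : ∀ d, a (p + d * s) = a p := by
    intro d
    induction d with
    | zero => simp
    | succ d ih => rw [Nat.succ_mul, ← add_assoc, hper, ih]
  have hex : ∃ α, n < α ∧ (s : ℤ) ≤ a α := by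
    refine ⟨p + (n + 1) * s, ?_, by rwa [hmul]⟩
    nlinarith
  obtain ⟨h1, h2⟩ := Nat.find_spec hex
  have h3 := fun k => Nat.find_min hex (m := k)
  set α := Nat.find hex
  have h4 := Nat.findGreatest_spec (P := fun k => a k < 0) (n := α) h1.le hn
  have h4' := Nat.le_findGreatest (P := fun k => a k < 0) (n := α) h1.le hn
  have h5 := Nat.findGreatest_le (P := fun k => a k < 0) α
  have h6 := fun k => Nat.findGreatest_is_greatest (P := fun k => a k < 0) (n := α) (k := k)
  set β := Nat.findGreatest (fun k => a k < 0) α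
  have hβα : β ≠ α := by
    rintro h
    rw [h] at h4
    linarith [Int.natCast_nonneg s]
  have hsβ : α < β + s := by
    by_contra! h
    have h7 := hper β
    rcases h.lt_or_eq with h | h
    · exact h6 (β + s) (by omega) h.le (by rw [h7]; exact h4)
    · rw [h] at h7
      linarith [Int.natCast_nonneg s]
  obtain ⟨m, hm1, hm2⟩ := exists_shift_of_aligned s t (fun k => a (k + α))
    (fun k => by rw [add_right_comm]; exact hper _)
    (fun k => by rw [add_right_comm]; exact hstep _) (by simpa using h2) (β + s - α) (by omega)
    (by rw [show β + s - α + α = β + s by omega, hper]; exact h4)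
    (fun k hk hks => by
      have h7 : a (k + α) = a (k + α - s) := by
        rw [← hper (k + α - s)]; congr 1; omega
      rw [h7]
      refine ⟨not_lt.1 (h6 _ (by omega) (by omega)), ?_⟩
      have := h3 (k + α - s) (by omega)
      rw [not_and, not_le] at this
      exact this (by omega))
  rw [sum_range_add_of_periodic s a hper (fun x => (x / s).toNat)] at hm1
  rw [sum_range_add_of_periodic s a hper (fun x => (-(x / s)).toNat)] at hm2
  exact ⟨m, hm1, hm2⟩

theorem nth_spec_of_lt_count (q : ℕ → Prop) [DecidablePred q] {N r : ℕ} (h : r < Nat.count q N) :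
    q (Nat.nth q r) ∧ Nat.nth q r < N ∧ Nat.count q (Nat.nth q r) = r := by
  have hr : ∀ hf : (Set.ofPred q).Finite, r < hf.toFinset.card :=
    fun hf => h.trans_le (Nat.count_le_card hf N)
  exact ⟨Nat.nth_mem r hr, Nat.nth_lt_of_lt_count h, Nat.count_nth hr⟩

theorem le_nth_iff_count_le (q : ℕ → Prop) [DecidablePred q] {N r m : ℕ} (h : r < Nat.count q N) :
    m ≤ Nat.nth q r ↔ Nat.count q m ≤ r := by
  refine ⟨Nat.le_nth_of_count_le, fun hm => ?_⟩
  obtain ⟨h1, -, h3⟩ := nth_spec_of_lt_count q h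
  by_contra! hlt
  have := Nat.count_strict_mono h1 hlt
  omega

theorem count_add_count_not (p : ℕ → Prop) [DecidablePred p] (n : ℕ) :
    Nat.count p n + Nat.count (fun k => ¬ p k) n = n := by
  induction n with
  | zero => simp
  | succ n ih =>
    rw [Nat.count_succ, Nat.count_succ]
    by_cases h : p n <;> simp [h] <;> omega

/-- The Young diagram whose beads are the numbers below `N` not satisfying `p`. Its rows, from
top to bottom, correspond to these numbers in decreasing order, and the length of a row is the
number of `y` with `p y` below the corresponding number. -/
noncomputable def gapDiagram (p : ℕ → Prop) [DecidablePred p] (N : ℕ) : YoungDiagram where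
  cells := (Finset.range (Nat.count (fun k => ¬ p k) N) ×ˢ Finset.range N).filter fun c =>
    c.2 < Nat.count p (Nat.nth (fun k => ¬ p k) (Nat.count (fun k => ¬ p k) N - 1 - c.1))
  isLowerSet := by
    rintro ⟨i, j⟩ ⟨i', j'⟩ ⟨hi, hj⟩ h
    simp only [Finset.coe_filter, Finset.mem_product, Finset.mem_range, Set.mem_ofPred_eq] at h ⊢
    simp only at hi hj
    refine ⟨⟨by omega, by omega⟩, ?_⟩
    have hm := Nat.count_monotone p ((le_nth_iff_count_le (fun k => ¬ p k)
      (N := N) (r := Nat.count (fun k => ¬ p k) N - 1 - i')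
      (m := Nat.nth (fun k => ¬ p k) (Nat.count (fun k => ¬ p k) N - 1 - i)) (by omega)).2 (by
        rw [(nth_spec_of_lt_count (fun k => ¬ p k) (N := N) (by omega)).2.2]; omega))
    omega

theorem mem_gapDiagram (p : ℕ → Prop) [DecidablePred p] (N i j : ℕ) :
    (i, j) ∈ gapDiagram p N ↔ i < Nat.count (fun k => ¬ p k) N ∧
      j < Nat.count p (Nat.nth (fun k => ¬ p k) (Nat.count (fun k => ¬ p k) N - 1 - i)) := by
  rw [← YoungDiagram.mem_cells]
  simp only [gapDiagram, Finset.mem_filter, Finset.mem_product, Finset.mem_range]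
  refine ⟨fun h => ⟨h.1.1, h.2⟩, fun h => ⟨⟨h.1, ?_⟩, h.2⟩⟩
  have h1 := (nth_spec_of_lt_count (fun k => ¬ p k) (N := N)
    (r := Nat.count (fun k => ¬ p k) N - 1 - i) (by omega)).2.1
  have h2 := Nat.count_le (p := p)
    (n := Nat.nth (fun k => ¬ p k) (Nat.count (fun k => ¬ p k) N - 1 - i))
  omega

theorem mem_gapDiagram_of_count (p : ℕ → Prop) [DecidablePred p] (N i j m : ℕ)
    (hi : i + Nat.count (fun k => ¬ p k) m < Nat.count (fun k => ¬ p k) N)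
    (hj : j < Nat.count p m) : (i, j) ∈ gapDiagram p N := by
  rw [mem_gapDiagram]
  refine ⟨by omega, hj.trans_le (Nat.count_monotone p ?_)⟩
  rw [le_nth_iff_count_le (fun k => ¬ p k) (N := N) (by omega)]
  omega

theorem exists_hookLength_gapDiagram (p : ℕ → Prop) [DecidablePred p] (N i j : ℕ)
    (h : (i, j) ∈ gapDiagram p N) :
    ∃ x y, ¬ p x ∧ p y ∧ y + (gapDiagram p N).hookLength i j = x := by
  have hmem := (mem_gapDiagram p N i j).1 h
  set q : ℕ → Prop := fun k => ¬ p k with hq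
  set G := Nat.count q N with hG
  obtain ⟨hx1, hx2, hx3⟩ := nth_spec_of_lt_count q (N := N) (r := G - 1 - i) (by omega)
  obtain ⟨hy1, hy2, hy3⟩ := nth_spec_of_lt_count p hmem.2
  set x := Nat.nth q (G - 1 - i) with hx
  set y := Nat.nth p j with hy
  have hxc := count_add_count_not p x
  have hyc := count_add_count_not p y
  have hrow : (gapDiagram p N).rowLen i = Nat.count p x := by
    refine eq_of_forall_lt_iff fun l => ?_
    rw [← YoungDiagram.mem_iff_lt_rowLen, mem_gapDiagram]
    exact and_iff_right hmem.1
  have hcol : (gapDiagram p N).colLen j = G - Nat.count q y := by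
    refine eq_of_forall_lt_iff fun l => ?_
    rw [← YoungDiagram.mem_iff_lt_colLen, mem_gapDiagram]
    change l < G ∧ j < Nat.count p (Nat.nth q (G - 1 - l)) ↔ _
    have key (hl : l < G) : j < Nat.count p (Nat.nth q (G - 1 - l)) ↔
        Nat.count q y ≤ G - 1 - l := by
      rw [← le_nth_iff_count_le q (N := N) (by omega)]
      obtain ⟨hz1, hz2, hz3⟩ := nth_spec_of_lt_count q (N := N) (r := G - 1 - l) (by omega)
      constructor
      · intro h
        exact (nth_spec_of_lt_count p h).2.1.le
      · intro h
        have hne : y ≠ Nat.nth q (G - 1 - l) := fun e => hz1 (e ▸ hy1)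
        have := Nat.count_strict_mono hy1 (lt_of_le_of_ne h hne)
        omega
    constructor
    · rintro ⟨h1, h2⟩
      have := (key h1).1 h2
      omega
    · intro h1
      have hl : l < G := by omega
      exact ⟨hl, (key hl).2 (by omega)⟩
  refine ⟨x, y, hx1, hy1, ?_⟩
  have hqm := Nat.count_monotone q hy2.le
  rw [YoungDiagram.hookLength, hrow, hcol]
  simp only [← hq] at hxc hyc
  omega

theorem isCore_gapDiagram (p : ℕ → Prop) [DecidablePred p] (N t : ℕ) (h : ∀ y, p y → p (y + t)) :
    (gapDiagram p N).IsCore t := by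
  rintro ⟨i, j⟩ hc heq
  obtain ⟨x, y, hx, hy, hxy⟩ := exists_hookLength_gapDiagram p N i j hc
  simp only at heq
  rw [heq] at hxy
  exact hx (hxy ▸ h y hy)

theorem card_gapDiagram (p : ℕ → Prop) [DecidablePred p] (N : ℕ) :
    (gapDiagram p N).card + ∑ r ∈ Finset.range (Nat.count (fun k => ¬ p k) N), r =
      ∑ x ∈ Finset.range N with ¬ p x, x := by
  set q : ℕ → Prop := fun k => ¬ p k with hq
  set G := Nat.count q N with hG
  have hcard : (gapDiagram p N).card = ∑ r ∈ Finset.range G, Nat.count p (Nat.nth q r) := by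
    have h1 : (gapDiagram p N).cells =
        ((Finset.range G).sigma fun i => Finset.range (Nat.count p (Nat.nth q (G - 1 - i)))).map
          (Equiv.sigmaEquivProd ℕ ℕ).toEmbedding := by
      ext ⟨i, j⟩
      rw [YoungDiagram.mem_cells, mem_gapDiagram]
      simp [← hq, ← hG, Finset.mem_map_equiv]
    rw [YoungDiagram.card, h1, Finset.card_map, Finset.card_sigma]
    simp only [Finset.card_range]
    exact Finset.sum_range_reflect (fun r => Nat.count p (Nat.nth q r)) G
  rw [hcard, ← Finset.sum_add_distrib, Finset.sum_filter]
  have h2 := sum_ite_count q (fun r => Nat.nth q r) N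
  have h3 : ∑ k ∈ Finset.range N, (if q k then Nat.nth q (Nat.count q k) else 0) =
      ∑ k ∈ Finset.range N, (if q k then k else 0) := by
    refine Finset.sum_congr rfl fun k _ => ?_
    split_ifs with h
    · exact Nat.nth_count h
    · rfl
  rw [← h3, h2]
  refine Finset.sum_congr rfl fun r hr => ?_
  have h4 := (nth_spec_of_lt_count q (Finset.mem_range.1 hr)).2.2
  have h5 := count_add_count_not p (Nat.nth q r)
  simp only [← hq] at h5
  omega

theorem exists_runner (s t : ℕ) (hs : 0 < s) (hst : Nat.Coprime s t) (x : ℤ) :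
    ∃ k : ℕ, k < s ∧ (s : ℤ) ∣ x - k * t := by
  have hs' : (0 : ℤ) < s := by exact_mod_cast hs
  have hb : (s : ℤ) * s.gcdA t + t * s.gcdB t = 1 := by
    rw [← Nat.gcd_eq_gcd_ab, hst]; rfl
  refine ⟨((x * s.gcdB t) % s).toNat, ?_, ?_⟩
  · have := Int.emod_lt_of_pos (x * s.gcdB t) hs'
    omega
  · rw [Int.toNat_of_nonneg (Int.emod_nonneg _ hs'.ne')]
    have h := Int.mul_ediv_add_emod (x * s.gcdB t) s
    refine ⟨x * s.gcdA t + t * (x * s.gcdB t / s), ?_⟩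
    linear_combination (-x) * hb + (-(t : ℤ)) * h

theorem runner_injective (s t : ℕ) (hst : Nat.Coprime s t) (k k' : ℕ) (hk : k < s) (hk' : k' < s)
    (h : (s : ℤ) ∣ k * t - k' * t) : k = k' := by
  rw [← sub_mul] at h
  have h1 : (s : ℤ) ∣ k - k' :=
    (Int.isCoprime_iff_gcd_eq_one.2 (by simpa using hst)).dvd_of_dvd_mul_right h
  have h2 := Int.eq_zero_of_abs_lt_dvd h1 (by rw [abs_lt]; omega)
  omega

/-- Membership in the additive submonoid of `ℕ` generated by `s` and `t`. -/
def IsNatCombination (s t n : ℕ) : Prop := ∃ a b : ℕ, n = a * s + b * t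

theorem isNatCombination_iff (s t : ℕ) (hst : Nat.Coprime s t) (n k : ℕ) (hk : k < s)
    (h : (s : ℤ) ∣ n - k * t) : IsNatCombination s t n ↔ k * t ≤ n := by
  constructor
  · rintro ⟨a, b, rfl⟩
    have h1 : (s : ℤ) ∣ ((b % s : ℕ) : ℤ) * t - k * t := by
      have h2 : ((b % s : ℕ) : ℤ) = b - s * (b / s : ℕ) := by
        have := Nat.mod_add_div b s
        zify at this ⊢
        linarith
      obtain ⟨c, hc⟩ := h
      refine ⟨c - a - (b / s : ℕ) * t, ?_⟩
      rw [h2]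
      push_cast at hc ⊢
      linear_combination hc
    have h3 := runner_injective s t hst _ k (Nat.mod_lt _ (by omega)) hk h1
    have h4 := Nat.mul_le_mul_right t (Nat.mod_le b s)
    rw [h3] at h4
    omega
  · intro hle
    obtain ⟨c, hc⟩ := h
    have hs : (0 : ℤ) < s := by omega
    have hc0 : 0 ≤ c := by
      have : (0 : ℤ) ≤ s * c := by
        rw [← hc, sub_nonneg]
        exact_mod_cast hle
      exact nonneg_of_mul_nonneg_right this hs
    refine ⟨c.toNat, k, ?_⟩
    zify
    rw [Int.toNat_of_nonneg hc0]
    linarith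

theorem isNatCombination_of_le (s t : ℕ) (hs : 0 < s) (hst : Nat.Coprime s t) (n : ℕ)
    (h : s * t ≤ n) : IsNatCombination s t n := by
  obtain ⟨k, hk, hd⟩ := exists_runner s t hs hst n
  rw [isNatCombination_iff s t hst n k hk hd]
  exact (Nat.mul_le_mul_right t hk.le).trans h

theorem sum_le_count (s t : ℕ) (hs : 0 < s) (hst : Nat.Coprime s t)
    [DecidablePred (IsNatCombination s t)] (m : ℕ) :
    ∑ k ∈ Finset.range s, (-(((k : ℤ) * t - m) / s)).toNat ≤
      Nat.count (IsNatCombination s t) m := by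
  have hs' : (0 : ℤ) < s := by exact_mod_cast hs
  rw [Nat.count_eq_card_filter_range]
  have h := Finset.card_sigma (Finset.range s)
    (fun k => Finset.range (-(((k : ℤ) * t - m) / s)).toNat)
  simp only [Finset.card_range] at h
  rw [← h]
  refine Finset.card_le_card_of_injOn (fun c => c.1 * t + s * c.2) ?_ ?_
  · rintro ⟨k, l⟩ hkl
    simp only [Finset.coe_sigma, Set.mem_sigma_iff, Finset.mem_coe, Finset.mem_range] at hkl
    simp only [Finset.coe_filter, Finset.mem_range, Set.mem_ofPred_eq]
    refine ⟨?_, l, k, by ring⟩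
    have h1 : ((k : ℤ) * t - m) / s < -l := by omega
    have h2 := (Int.ediv_lt_iff_lt_mul hs').1 h1
    zify
    linarith
  · rintro ⟨k, l⟩ hkl ⟨k', l'⟩ hkl' heq
    simp only [Finset.coe_sigma, Set.mem_sigma_iff, Finset.mem_coe, Finset.mem_range]
      at hkl hkl' heq
    have hk := runner_injective s t hst k k' hkl.1 hkl'.1 ⟨(l' : ℤ) - l, by
      zify at heq
      linear_combination heq⟩
    subst hk
    have : s * l = s * l' := by omega
    rw [Nat.eq_of_mul_eq_mul_left hs this]

theorem not_isNatCombination_iff (s t : ℕ) (hs : 0 < s) (hst : Nat.Coprime s t) (x : ℕ) :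
    ¬ IsNatCombination s t x ↔ ∃ k l : ℕ, k < s ∧ x + s * (l + 1) = k * t := by
  have hs' : (0 : ℤ) < s := by exact_mod_cast hs
  obtain ⟨k, hk, hd⟩ := exists_runner s t hs hst x
  constructor
  · intro hx
    rw [isNatCombination_iff s t hst x k hk hd, not_le] at hx
    obtain ⟨c, hc⟩ := hd
    have hc0 : c < 0 := by
      zify at hx
      by_contra! h
      have := mul_nonneg hs'.le h
      linarith
    refine ⟨k, (-c - 1).toNat, hk, ?_⟩
    zify
    rw [Int.toNat_of_nonneg (by omega)]
    linear_combination hc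
  · rintro ⟨k', l, hk', h⟩
    have hpos : 0 < s * (l + 1) := by positivity
    rw [isNatCombination_iff s t hst x k' hk' ⟨-(l + 1), by
      zify at h
      linear_combination h⟩]
    omega

theorem sum_le_count_not (s t : ℕ) (hs : 0 < s) (hst : Nat.Coprime s t)
    [DecidablePred (IsNatCombination s t)] (m : ℕ) :
    ∑ k ∈ Finset.range s, (((k : ℤ) * t - m) / s).toNat +
      Nat.count (fun n => ¬ IsNatCombination s t n) m ≤
        Nat.count (fun n => ¬ IsNatCombination s t n) (s * t) := by
  have hs' : (0 : ℤ) < s := by exact_mod_cast hs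
  rw [Nat.count_eq_card_filter_range, Nat.count_eq_card_filter_range]
  have h := Finset.card_sigma (Finset.range s)
    (fun k => Finset.range (((k : ℤ) * t - m) / s).toNat)
  simp only [Finset.card_range] at h
  rw [← h]
  set T := (Finset.range s).sigma (fun k => Finset.range (((k : ℤ) * t - m) / s).toNat)
  have hT : ∀ c ∈ T, c.1 < s ∧ m + s * (c.2 + 1) ≤ c.1 * t := by
    rintro ⟨k, l⟩ hkl
    simp only [T, Finset.mem_sigma, Finset.mem_range] at hkl
    refine ⟨hkl.1, ?_⟩
    have h1 : (l : ℤ) + 1 ≤ ((k : ℤ) * t - m) / s := by omega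
    have h2 := (Int.le_ediv_iff_mul_le hs').1 h1
    zify
    linarith
  have himg : (T.image fun c => c.1 * t - s * (c.2 + 1)).card = T.card := by
    refine Finset.card_image_of_injOn ?_
    rintro ⟨k, l⟩ hkl ⟨k', l'⟩ hkl' heq
    have h1 := hT _ hkl
    have h2 := hT _ hkl'
    simp only at h1 h2 heq
    have h3 : k * t + s * (l' + 1) = k' * t + s * (l + 1) := by omega
    have hk := runner_injective s t hst k k' h1.1 h2.1 ⟨(l : ℤ) - l', by
      zify at h3
      linear_combination h3⟩
    subst hk
    have : s * l = s * l' := by grind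
    rw [Nat.eq_of_mul_eq_mul_left hs this]
  rw [← himg, ← Finset.card_union_of_disjoint]
  · refine Finset.card_le_card fun x hx => ?_
    simp only [Finset.mem_union, Finset.mem_image, Finset.mem_filter, Finset.mem_range] at hx ⊢
    have hmem : ¬ IsNatCombination s t x := by
      rcases hx with ⟨c, hc, rfl⟩ | hx
      · have := hT c hc
        exact (not_isNatCombination_iff s t hs hst _).2 ⟨c.1, c.2, this.1, by omega⟩
      · exact hx.2
    refine ⟨?_, hmem⟩
    by_contra! hle
    exact hmem (isNatCombination_of_le s t hs hst x hle)
  · rw [Finset.disjoint_left]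
    intro x hx hx'
    simp only [Finset.mem_image, Finset.mem_filter, Finset.mem_range] at hx hx'
    obtain ⟨c, hc, rfl⟩ := hx
    have := hT c hc
    omega

theorem sum_gaps (s t : ℕ) (hs : 0 < s) (hst : Nat.Coprime s t)
    [DecidablePred (IsNatCombination s t)] (f : ℕ → ℤ) :
    ∑ x ∈ Finset.range (s * t) with ¬ IsNatCombination s t x, f x =
      ∑ k ∈ Finset.range s, ∑ l ∈ Finset.range (k * t / s), f (k * t - s * (l + 1)) := by
  rw [Finset.sum_sigma' (Finset.range s) (fun k => Finset.range (k * t / s))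
    (fun k l => f (k * t - s * (l + 1)))]
  have hT (k l : ℕ) (h : l < k * t / s) : s * (l + 1) ≤ k * t := by
    have := (Nat.le_div_iff_mul_le hs).1 (Nat.succ_le_of_lt h)
    rwa [mul_comm]
  symm
  refine Finset.sum_bij (fun c _ => c.1 * t - s * (c.2 + 1)) ?_ ?_ ?_ fun _ _ => rfl
  · rintro ⟨k, l⟩ h
    simp only [Finset.mem_sigma, Finset.mem_range, Finset.mem_filter] at h ⊢
    have := hT k l h.2
    have hmem := (not_isNatCombination_iff s t hs hst (k * t - s * (l + 1))).2
      ⟨k, l, h.1, by omega⟩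
    refine ⟨?_, hmem⟩
    by_contra! hle
    exact hmem (isNatCombination_of_le s t hs hst _ hle)
  · rintro ⟨k, l⟩ h ⟨k', l'⟩ h' heq
    simp only [Finset.mem_sigma, Finset.mem_range] at h h' heq
    have h1 := hT k l h.2
    have h2 := hT k' l' h'.2
    have h3 : k * t + s * (l' + 1) = k' * t + s * (l + 1) := by omega
    have hk := runner_injective s t hst k k' h.1 h'.1 ⟨(l : ℤ) - l', by
      zify at h3
      linear_combination h3⟩
    subst hk
    have : s * l = s * l' := by grind
    rw [Nat.eq_of_mul_eq_mul_left hs this]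
  · intro x hx
    simp only [Finset.mem_filter] at hx
    obtain ⟨k, l, hk, h⟩ := (not_isNatCombination_iff s t hs hst x).1 hx.2
    refine ⟨⟨k, l⟩, ?_, by simp only; omega⟩
    simp only [Finset.mem_sigma, Finset.mem_range]
    refine ⟨hk, ?_⟩
    rw [Nat.lt_iff_add_one_le, Nat.le_div_iff_mul_le hs, mul_comm]
    omega

theorem sum_mul_mod (s t : ℕ) (hs : 0 < s) (hst : Nat.Coprime s t) (f : ℕ → ℤ) :
    ∑ k ∈ Finset.range s, f (k * t % s) = ∑ k ∈ Finset.range s, f k := by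
  have hinj : Set.InjOn (fun k => k * t % s) (Finset.range s) := by
    intro k hk k' hk' h
    simp only [Finset.coe_range, Set.mem_Iio] at hk hk' h
    refine runner_injective s t hst k k' hk hk' ?_
    have := (Nat.modEq_iff_dvd.1 (show k' * t ≡ k * t [MOD s] from h.symm))
    exact_mod_cast this
  have himg : (Finset.range s).image (fun k => k * t % s) = Finset.range s := by
    refine Finset.eq_of_subset_of_card_le (fun x hx => ?_) ?_
    · obtain ⟨k, -, rfl⟩ := Finset.mem_image.1 hx
      exact Finset.mem_range.2 (Nat.mod_lt _ hs)
    · rw [Finset.card_image_of_injOn hinj]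
  conv_rhs => rw [← himg, Finset.sum_image hinj]

theorem two_mul_sum_range (n : ℕ) : 2 * ∑ k ∈ Finset.range n, (k : ℤ) = n * (n - 1) := by
  induction n with
  | zero => simp
  | succ n ih => rw [Finset.sum_range_succ, mul_add, ih]; push_cast; ring

theorem six_mul_sum_range_sq (n : ℕ) :
    6 * ∑ k ∈ Finset.range n, (k : ℤ) ^ 2 = n * (n - 1) * (2 * n - 1) := by
  induction n with
  | zero => simp
  | succ n ih => rw [Finset.sum_range_succ, mul_add, ih]; push_cast; ring

theorem two_mul_count_gaps (s t : ℕ) (hs : 0 < s) (hst : Nat.Coprime s t)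
    [DecidablePred (IsNatCombination s t)] :
    2 * (Nat.count (fun n => ¬ IsNatCombination s t n) (s * t) : ℤ) = (s - 1) * (t - 1) := by
  have hs' : (0 : ℤ) < s := by exact_mod_cast hs
  have h := sum_gaps s t hs hst (fun _ => 1)
  simp only [Finset.sum_const, Finset.card_range, nsmul_eq_mul, mul_one] at h
  rw [Nat.count_eq_card_filter_range, h]
  have hq : (s : ℤ) * ∑ k ∈ Finset.range s, ((k * t / s : ℕ) : ℤ) =
      (t - 1) * ∑ k ∈ Finset.range s, (k : ℤ) := by
    have h1 := sum_mul_mod s t hs hst (fun k => (k : ℤ))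
    have h2 : ∑ k ∈ Finset.range s, ((s : ℤ) * ((k * t / s : ℕ) : ℤ) + ((k * t % s : ℕ) : ℤ)) =
        ∑ k ∈ Finset.range s, (k : ℤ) * t :=
      Finset.sum_congr rfl fun k _ => by exact_mod_cast Nat.div_add_mod (k * t) s
    rw [Finset.sum_add_distrib, h1, ← Finset.mul_sum, ← Finset.sum_mul] at h2
    linarith
  have h3 := two_mul_sum_range s
  refine mul_left_cancel₀ hs'.ne' ?_
  linear_combination 2 * hq + (t - 1) * h3

theorem twelve_mul_sum_gaps (s t : ℕ) (hs : 0 < s) (hst : Nat.Coprime s t)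
    [DecidablePred (IsNatCombination s t)] :
    12 * ∑ x ∈ Finset.range (s * t) with ¬ IsNatCombination s t x, (x : ℤ) =
      (s - 1) * (t - 1) * (2 * s * t - s - t - 1) := by
  have hs' : (0 : ℤ) < s := by exact_mod_cast hs
  rw [sum_gaps s t hs hst (fun x => (x : ℤ))]
  have hinner (k : ℕ) : 2 * s * ∑ l ∈ Finset.range (k * t / s), ((k * t - s * (l + 1) : ℕ) : ℤ) =
      (t ^ 2 * (k : ℤ) ^ 2 - s * t * k) - (((k * t % s : ℕ) : ℤ) ^ 2 - s * (k * t % s : ℕ)) := by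
    have h1 : ∑ l ∈ Finset.range (k * t / s), ((k * t - s * (l + 1) : ℕ) : ℤ) =
        ∑ l ∈ Finset.range (k * t / s), (((k : ℤ) * t - s) - s * l) := by
      refine Finset.sum_congr rfl fun l hl => ?_
      have := (Nat.le_div_iff_mul_le hs).1 (Nat.succ_le_of_lt (Finset.mem_range.1 hl))
      rw [Nat.cast_sub (by rw [mul_comm]; exact this)]
      push_cast
      ring
    rw [h1, Finset.sum_sub_distrib, ← Finset.mul_sum, Finset.sum_const, Finset.card_range,
      nsmul_eq_mul]
    have h2 := two_mul_sum_range (k * t / s)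
    have h3 : (s : ℤ) * ((k * t / s : ℕ) : ℤ) + ((k * t % s : ℕ) : ℤ) = k * t := by
      exact_mod_cast Nat.div_add_mod (k * t) s
    generalize ((k * t / s : ℕ) : ℤ) = q at *
    generalize ((k * t % s : ℕ) : ℤ) = r at *
    generalize ∑ l ∈ Finset.range (k * t / s), (l : ℤ) = σ at *
    have h4 : r = k * t - s * q := by linarith
    subst h4
    linear_combination (-(s : ℤ) ^ 2) * h2
  have hsum : 2 * (s : ℤ) * ∑ k ∈ Finset.range s,
      ∑ l ∈ Finset.range (k * t / s), ((k * t - s * (l + 1) : ℕ) : ℤ) =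
      (t ^ 2 - 1) * ∑ k ∈ Finset.range s, (k : ℤ) ^ 2
        - s * (t - 1) * ∑ k ∈ Finset.range s, (k : ℤ) := by
    rw [Finset.mul_sum, Finset.sum_congr rfl fun k _ => hinner k, Finset.sum_sub_distrib,
      sum_mul_mod s t hs hst (fun k => (k : ℤ) ^ 2 - s * k), Finset.sum_sub_distrib,
      Finset.sum_sub_distrib, ← Finset.mul_sum, ← Finset.mul_sum, ← Finset.mul_sum]
    ring
  have h5 := two_mul_sum_range s
  have h6 := six_mul_sum_range_sq s
  refine mul_left_cancel₀ hs'.ne' ?_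
  linear_combination 6 * hsum + (t ^ 2 - 1) * h6 - 3 * s * (t - 1) * h5

theorem card_gapDiagram_isNatCombination (s t : ℕ) (hs : 0 < s) (ht : 0 < t)
    (hst : Nat.Coprime s t) [DecidablePred (IsNatCombination s t)] :
    (gapDiagram (IsNatCombination s t) (s * t)).card = (s ^ 2 - 1) * (t ^ 2 - 1) / 24 := by
  have h1 := card_gapDiagram (IsNatCombination s t) (s * t)
  have h2 := two_mul_count_gaps s t hs hst
  have h3 := twelve_mul_sum_gaps s t hs hst
  have h4 := two_mul_sum_range (Nat.count (fun n => ¬ IsNatCombination s t n) (s * t))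
  zify at h1
  generalize (Nat.count (fun n => ¬ IsNatCombination s t n) (s * t) : ℤ) = G at *
  have h5 : 24 * (gapDiagram (IsNatCombination s t) (s * t)).card =
      (s ^ 2 - 1) * (t ^ 2 - 1) := by
    zify [Nat.one_le_pow 2 s hs, Nat.one_le_pow 2 t ht]
    linear_combination 24 * h1 + 2 * h3 - 12 * h4
      - 3 * (2 * G - 2 + (s - 1) * (t - 1)) * h2
  omega

namespace YoungDiagram

/-- The bead of the `i`-th row of a Young diagram. -/
def bead (μ : YoungDiagram) (i : ℕ) : ℤ := μ.rowLen i - i - 1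

/-- The space of the `j`-th column of a Young diagram. -/
def space (μ : YoungDiagram) (j : ℕ) : ℤ := j - μ.colLen j

theorem bead_strictAnti (μ : YoungDiagram) : StrictAnti μ.bead := fun i i' h => by
  have := μ.rowLen_anti i i' h.le
  simp only [bead]
  omega

theorem space_strictMono (μ : YoungDiagram) : StrictMono μ.space := fun j j' h => by
  have := μ.colLen_anti j j' h.le
  simp only [space]
  omega

theorem space_lt_bead_iff (μ : YoungDiagram) (i j : ℕ) : μ.space j < μ.bead i ↔ (i, j) ∈ μ := by
  have h1 := μ.mem_iff_lt_rowLen (i := i) (j := j)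
  have h2 := μ.mem_iff_lt_colLen (i := i) (j := j)
  simp only [bead, space]
  by_cases h : (i, j) ∈ μ
  · simp only [h, true_iff, iff_true] at *
    omega
  · simp only [h, false_iff, iff_false] at *
    omega

theorem bead_ne_space (μ : YoungDiagram) (i j : ℕ) : μ.bead i ≠ μ.space j := by
  have h1 := μ.mem_iff_lt_rowLen (i := i) (j := j)
  have h2 := μ.mem_iff_lt_colLen (i := i) (j := j)
  have h3 := h1.symm.trans h2
  simp only [bead, space]
  omega

theorem exists_bead_lt (μ : YoungDiagram) (x : ℤ) : ∃ i, μ.bead i < x := by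
  have := μ.rowLen_anti 0 (μ.rowLen 0 + (-x).toNat) (Nat.zero_le _)
  exact ⟨μ.rowLen 0 + (-x).toNat, by simp only [bead]; omega⟩

theorem exists_space_eq (μ : YoungDiagram) (x : ℤ) (hx : ∀ i, μ.bead i ≠ x) :
    ∃ j, μ.space j = x := by
  classical
  have hex := μ.exists_bead_lt x
  have h1 := Nat.find_spec hex
  have h2 := fun i => Nat.find_min hex (m := i)
  set i := Nat.find hex
  have h3 : μ.rowLen i ≤ x + i := by simp only [bead] at h1; omega
  obtain ⟨j, hj⟩ := Int.eq_ofNat_of_zero_le (show 0 ≤ x + i by omega)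
  have h4 : ¬ i < μ.colLen j := by
    rw [← mem_iff_lt_colLen, mem_iff_lt_rowLen]
    omega
  have h5 : i ≤ μ.colLen j := by
    rcases Nat.eq_zero_or_pos i with hi | hi
    · omega
    have h6 := h2 (i - 1) (by omega)
    have h7 := hx (i - 1)
    have h8 : i - 1 < μ.colLen j := by
      rw [← mem_iff_lt_colLen, mem_iff_lt_rowLen]
      simp only [bead] at h6 h7
      omega
    omega
  refine ⟨j, ?_⟩
  simp only [space]
  omega

theorem IsCore.bead_ne_add {μ : YoungDiagram} {t : ℕ} (h : μ.IsCore t) (ht : 0 < t) {x : ℤ}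
    (hx : ∀ i, μ.bead i ≠ x) (i : ℕ) : μ.bead i ≠ x + t := by
  intro heq
  obtain ⟨j, hj⟩ := μ.exists_space_eq x hx
  have hmem : (i, j) ∈ μ := (μ.space_lt_bead_iff i j).1 (by omega)
  refine h (i, j) hmem ?_
  have h1 := mem_iff_lt_rowLen.1 hmem
  have h2 := mem_iff_lt_colLen.1 hmem
  simp only [bead, space, hookLength] at *
  omega

end YoungDiagram

theorem card_le_sum_of_runner (s t i : ℕ) (hs : 0 < s) (hst : Nat.Coprime s t) (x z : ℕ → ℤ)
    (c : ℕ → ℕ) (hz0 : ∀ r < i, 0 ≤ z r)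
    (hz : ∀ r < i, ∀ k : ℕ, (s : ℤ) ∣ x r - k * t → z r / s < c k)
    (hinj : ∀ r < i, ∀ r' < i, (s : ℤ) ∣ x r - x r' → z r / s = z r' / s → r = r') :
    i ≤ ∑ k ∈ Finset.range s, c k := by
  choose κ hκ hκd using fun r => exists_runner s t hs hst (x r)
  have h := Finset.card_sigma (Finset.range s) (fun k => Finset.range (c k))
  simp only [Finset.card_range] at h
  rw [← h]
  conv_lhs => rw [← Finset.card_range i]
  have hs' : (0 : ℤ) ≤ s := by positivity
  refine Finset.card_le_card_of_injOn (fun r => ⟨κ r, (z r / s).toNat⟩) ?_ ?_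
  · intro r hr
    have hr' : r < i := by simpa using hr
    have h1 := hz r hr' _ (hκd r)
    have h2 := Int.ediv_nonneg (hz0 r hr') hs'
    simp only [Finset.coe_sigma, Set.mem_sigma_iff, Finset.mem_coe, Finset.mem_range]
    exact ⟨hκ r, by omega⟩
  · intro r hr r' hr' heq
    have hr : r < i := by simpa using hr
    have hr' : r' < i := by simpa using hr'
    simp only [Sigma.mk.injEq, heq_eq_eq] at heq
    have h2 := Int.ediv_nonneg (hz0 r hr) hs'
    have h3 := Int.ediv_nonneg (hz0 r' hr') hs'
    refine hinj r hr r' hr' ?_ (by omega)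
    have h4 := hκd r
    rw [heq.1] at h4
    simpa using dvd_sub h4 (hκd r')

theorem eq_of_dvd_of_ediv_eq (s : ℕ) (x y : ℤ) (h : (s : ℤ) ∣ x - y)
    (hd : x / s = y / s) : x = y := by
  rw [← Int.mul_ediv_add_emod x s, ← Int.mul_ediv_add_emod y s, hd,
    Int.emod_eq_emod_iff_emod_sub_eq_zero.2 (Int.emod_eq_zero_of_dvd h)]

theorem mem_gapDiagram_of_isCore (s t : ℕ) (hs : 0 < s) (ht : 0 < t) (hst : Nat.Coprime s t)
    [DecidablePred (IsNatCombination s t)] (μ : YoungDiagram) (hμs : μ.IsCore s)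
    (hμt : μ.IsCore t) (i j : ℕ) (hij : (i, j) ∈ μ) :
    (i, j) ∈ gapDiagram (IsNatCombination s t) (s * t) := by
  have hs' : (0 : ℤ) < s := by exact_mod_cast hs
  have hadd (x : ℤ) (hx : ∀ i, μ.bead i ≠ x) (l : ℕ) : ∀ i, μ.bead i ≠ x + s * l := by
    induction l with
    | zero => simpa using hx
    | succ l ih =>
      have := hμs.bead_ne_add hs ih
      intro i
      push_cast
      rw [mul_add, mul_one, ← add_assoc]
      exact this i
  have hlow (x : ℤ) (hx : ∀ i, μ.bead i ≠ x) : μ.space 0 ≤ x := by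
    obtain ⟨j, rfl⟩ := μ.exists_space_eq x hx
    exact μ.space_strictMono.monotone (Nat.zero_le j)
  have hhigh (x : ℤ) (hx : μ.bead 0 < x) (i : ℕ) : μ.bead i ≠ x := by
    have := μ.bead_strictAnti.antitone (Nat.zero_le i)
    omega
  choose a ha hmin using fun k : ℕ => Int.exists_least_of_bdd
    (P := fun x => (∀ i, μ.bead i ≠ x) ∧ (s : ℤ) ∣ x - k * t)
    ⟨μ.space 0, fun x hx => hlow x hx.1⟩
    ⟨k * t + s * (|μ.bead 0| + |(k : ℤ) * t| + 1), hhigh _ (by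
      have h1 := le_abs_self (μ.bead 0)
      have h2 := neg_abs_le ((k : ℤ) * t)
      have h3 := abs_nonneg (μ.bead 0)
      have h4 := abs_nonneg ((k : ℤ) * t)
      nlinarith), by simp⟩
  have hper (k : ℕ) : a (k + s) = a k := by
    have hiff (x : ℤ) : (s : ℤ) ∣ x - (k + s : ℕ) * t ↔ (s : ℤ) ∣ x - k * t := by
      have : x - ((k + s : ℕ) : ℤ) * t = (x - k * t) - s * t := by push_cast; ring
      rw [this]
      exact dvd_sub_left (dvd_mul_right _ _)
    refine le_antisymm (hmin _ _ ⟨(ha k).1, (hiff _).2 (ha k).2⟩)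
      (hmin _ _ ⟨(ha _).1, (hiff _).1 (ha _).2⟩)
  have hstep (k : ℕ) : a (k + 1) ≤ a k + t := by
    refine hmin _ _ ⟨hμt.bead_ne_add ht (ha k).1, ?_⟩
    have h := (ha k).2
    have : a k + t - ((k + 1 : ℕ) : ℤ) * t = a k - k * t := by push_cast; ring
    rwa [this]
  set n := μ.bead i with hn
  have hbead (r k : ℕ) (hd : (s : ℤ) ∣ μ.bead r - k * t) : μ.bead r + s ≤ a k := by
    by_contra! hlt
    obtain ⟨c, hc⟩ : (s : ℤ) ∣ μ.bead r - a k := by simpa using dvd_sub hd (ha k).2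
    have hc0 : 0 ≤ c := by
      by_contra! h
      have : (s : ℤ) * c ≤ s * (-1) := mul_le_mul_of_nonneg_left (by omega) hs'.le
      linarith
    obtain ⟨l, rfl⟩ := Int.eq_ofNat_of_zero_le hc0
    exact hadd (a k) (ha k).1 l r (by linarith)
  have hspace (r k : ℕ) (hd : (s : ℤ) ∣ μ.space r - k * t) : a k ≤ μ.space r :=
    hmin k _ ⟨fun i => μ.bead_ne_space i r, hd⟩
  have hi : i + 1 ≤ ∑ k ∈ Finset.range s, ((a k - n) / s).toNat := by
    refine card_le_sum_of_runner s t (i + 1) hs hst μ.bead (fun r => μ.bead r - n) _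
      (fun r hr => sub_nonneg.2 (μ.bead_strictAnti.antitone (by omega))) ?_ ?_
    · intro r hr k hd
      have h1 := hbead r k hd
      have h2 : (μ.bead r - n) / s + 1 ≤ (a k - n) / s := by
        rw [Int.le_ediv_iff_mul_le hs', add_mul]
        have := Int.ediv_mul_le (μ.bead r - n) hs'.ne'
        linarith
      omega
    · intro r _ r' _ hd he
      have := eq_of_dvd_of_ediv_eq s _ _ (by simpa using hd) he
      exact μ.bead_strictAnti.injective (by linarith)
  have hj : j + 1 ≤ ∑ k ∈ Finset.range s, (-((a k - n) / s)).toNat := by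
    have hlt := (μ.space_lt_bead_iff i j).2 hij
    refine card_le_sum_of_runner s t (j + 1) hs hst μ.space (fun r => n - 1 - μ.space r) _ ?_ ?_ ?_
    · intro r hr
      have := μ.space_strictMono.monotone (show r ≤ j by omega)
      omega
    · intro r hr k hd
      have h1 := hspace r k hd
      have h2 : (a k - n) / s < -((n - 1 - μ.space r) / s) := by
        rw [Int.ediv_lt_iff_lt_mul hs']
        have := Int.ediv_mul_le (n - 1 - μ.space r) hs'.ne'
        linarith
      omega
    · intro r _ r' _ hd he
      have := eq_of_dvd_of_ediv_eq s _ _ (by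
        rw [← dvd_neg]
        simpa using hd) he
      exact μ.space_strictMono.injective (by linarith)
  obtain ⟨m, hm1, hm2⟩ := exists_shift s t (fun k => a k - n) (fun k => by simp only [hper])
    (fun k => by have := hstep k; linarith) (by
      obtain ⟨k, -, hk⟩ := exists_runner s t hs hst (μ.bead i)
      exact ⟨k, by have := hbead i k hk; linarith⟩) (by
      obtain ⟨k, -, hk⟩ := exists_runner s t hs hst (μ.space j)
      have := (μ.space_lt_bead_iff i j).2 hij
      exact ⟨k, by have := hspace j k hk; linarith⟩) hs
  have h1 := sum_le_count_not s t hs hst m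
  have h2 := sum_le_count s t hs hst m
  exact mem_gapDiagram_of_count _ _ i j m (by omega) (by omega)

theorem maximal_st_core (s t : ℕ) (hs : 2 ≤ s) (ht : 2 ≤ t) (hst : Nat.Coprime s t) :
    ∃! κ : YoungDiagram, κ.IsCore s ∧ κ.IsCore t ∧
      (∀ μ : YoungDiagram, μ.IsCore s → μ.IsCore t → μ ≤ κ) ∧
      κ.card = (s ^ 2 - 1) * (t ^ 2 - 1) / 24 := by
  classical
  have hs0 : 0 < s := by omega
  have ht0 : 0 < t := by omega
  have hcs : (gapDiagram (IsNatCombination s t) (s * t)).IsCore s :=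
    isCore_gapDiagram _ _ s fun y ⟨a, b, h⟩ => ⟨a + 1, b, by rw [h]; ring⟩
  have hct : (gapDiagram (IsNatCombination s t) (s * t)).IsCore t :=
    isCore_gapDiagram _ _ t fun y ⟨a, b, h⟩ => ⟨a, b + 1, by rw [h]; ring⟩
  have hmax (μ : YoungDiagram) (h1 : μ.IsCore s) (h2 : μ.IsCore t) :
      μ ≤ gapDiagram (IsNatCombination s t) (s * t) :=
    YoungDiagram.cells_subset_iff.1 fun c hc =>
      mem_gapDiagram_of_isCore s t hs0 ht0 hst μ h1 h2 c.1 c.2 hc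
  exact ⟨_, ⟨hcs, hct, hmax, card_gapDiagram_isNatCombination s t hs0 ht0 hst⟩,
    fun κ ⟨h1, h2, h3, _⟩ => le_antisymm (hmax κ h1 h2) (h3 _ hcs hct)⟩
end

section
/- For every integer k ≥ 1, the maximum of the sizes of all simultaneous (2k−1, 2k+1)-core partitions equals 4k²(k+1)(k−1)/6. -/
open Finset

namespace YoungDiagram

/-- The set of first-column hook lengths of `Y`, padded with zero rows to `N` rows. -/
def betaSet (Y : YoungDiagram) (N : ℕ) : Finset ℕ :=
  (range N).image fun i => Y.rowLen i + (N - 1 - i)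

theorem mem_betaSet {Y : YoungDiagram} {N x : ℕ} :
    x ∈ Y.betaSet N ↔ ∃ i < N, Y.rowLen i + (N - 1 - i) = x := by
  simp [betaSet]

theorem betaSet_injOn (Y : YoungDiagram) (N : ℕ) :
    Set.InjOn (fun i => Y.rowLen i + (N - 1 - i)) (range N : Set ℕ) := by
  intro i hi j hj h
  simp only [coe_range, Set.mem_Iio] at hi hj h
  rcases lt_trichotomy i j with hij | hij | hij
  · have := Y.rowLen_anti i j hij.le
    omega
  · exact hij
  · have := Y.rowLen_anti j i hij.le
    omega

theorem card_betaSet (Y : YoungDiagram) (N : ℕ) : (Y.betaSet N).card = N := by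
  rw [betaSet, card_image_of_injOn (Y.betaSet_injOn N), card_range]

theorem card_eq_sum_rowLen (Y : YoungDiagram) {N : ℕ} (hN : Y.colLen 0 ≤ N) :
    Y.card = ∑ i ∈ range N, Y.rowLen i := by
  rw [YoungDiagram.card, card_eq_sum_card_fiberwise (f := Prod.fst) (t := range N)]
  · refine sum_congr rfl fun i _ => ?_
    rw [rowLen_eq_card]
    rfl
  · rintro ⟨i, j⟩ h
    have h0 : (i, 0) ∈ Y := Y.up_left_mem le_rfl (Nat.zero_le j) h
    rw [mem_iff_lt_colLen] at h0
    simpa using h0.trans_le hN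

theorem sum_betaSet (Y : YoungDiagram) {N : ℕ} (hN : Y.colLen 0 ≤ N) :
    ∑ x ∈ Y.betaSet N, x = Y.card + ∑ i ∈ range N, i := by
  rw [betaSet, sum_image (Y.betaSet_injOn N), sum_add_distrib, ← Y.card_eq_sum_rowLen hN,
    sum_range_reflect (fun i => i) N]

theorem isCore_iff_betaSet (Y : YoungDiagram) {N t : ℕ} (hN : Y.colLen 0 ≤ N) (ht : 0 < t) :
    Y.IsCore t ↔ ∀ x ∈ Y.betaSet N, t ≤ x → x - t ∈ Y.betaSet N := by
  have hzero : Y.rowLen N = 0 := by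
    by_contra h
    have : (N, 0) ∈ Y := mem_iff_lt_rowLen.2 (Nat.pos_of_ne_zero h)
    rw [mem_iff_lt_colLen] at this
    omega
  constructor
  · intro hY x hx htx
    obtain ⟨i, hi, rfl⟩ := mem_betaSet.1 hx
    by_contra hy
    set y := Y.rowLen i + (N - 1 - i) - t with hydef
    have hex : ∃ r, N ≤ r ∨ Y.rowLen r + (N - 1 - r) ≤ y := ⟨N, Or.inl le_rfl⟩
    obtain ⟨r, hr, hmin⟩ : ∃ r, (N ≤ r ∨ Y.rowLen r + (N - 1 - r) ≤ y) ∧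
        ∀ m < r, ¬ (N ≤ m ∨ Y.rowLen m + (N - 1 - m) ≤ y) :=
      ⟨Nat.find hex, Nat.find_spec hex, fun m hm => Nat.find_min hex hm⟩
    have hrN : r ≤ N := by
      by_contra h
      exact hmin N (by omega) (Or.inl le_rfl)
    have hir : i < r := by
      by_contra h
      have := Y.rowLen_anti r i (by omega)
      omega
    have hpred := hmin (r - 1) (by omega)
    have hanti := Y.rowLen_anti i (r - 1) (by omega)
    have hr' : r = N ∨ r < N ∧ Y.rowLen r + (N - 1 - r) < y := by
      rcases hrN.eq_or_lt with h | h
      · exact Or.inl h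
      · refine Or.inr ⟨h, lt_of_le_of_ne (hr.resolve_left (by omega)) fun he => ?_⟩
        exact hy (mem_betaSet.2 ⟨r, h, he⟩)
    obtain ⟨j, hj⟩ : ∃ j, y + r = N + j := ⟨y + r - N, by omega⟩
    have hlast : (r - 1, j) ∈ Y := mem_iff_lt_rowLen.2 (by omega)
    have hnext : (r, j) ∉ Y := by
      rw [mem_iff_lt_rowLen]
      rcases hr' with rfl | h
      · omega
      · omega
    rw [mem_iff_lt_colLen] at hlast hnext
    refine hY (i, j) (mem_iff_lt_rowLen.2 (by omega)) ?_
    simp only [hookLength]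
    omega
  · rintro hX ⟨i, j⟩ hc hh
    have hrow : j < Y.rowLen i := mem_iff_lt_rowLen.1 hc
    have hcol : i < Y.colLen j := mem_iff_lt_colLen.1 hc
    have hcolN : Y.colLen j ≤ N := (Y.colLen_anti 0 j (Nat.zero_le j)).trans hN
    simp only [hookLength] at hh
    obtain ⟨r, hr, he⟩ := mem_betaSet.1 (hX _ (mem_betaSet.2 ⟨i, by omega, rfl⟩) (by omega))
    have hiff : j < Y.rowLen r ↔ r < Y.colLen j := by
      rw [← mem_iff_lt_rowLen, ← mem_iff_lt_colLen]
    omega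

theorem exists_betaSet_eq (X : Finset ℕ) :
    ∃ Y : YoungDiagram, Y.colLen 0 ≤ X.card ∧ Y.betaSet X.card = X := by
  set N := X.card with hNdef
  set f := X.orderEmbOfFin hNdef.symm with hf
  have hmono : ∀ p q (hp : p < N) (hq : q < N), p ≤ q → f ⟨p, hp⟩ + q ≤ f ⟨q, hq⟩ + p := by
    intro p q hp hq hpq
    induction q, hpq using Nat.le_induction with
    | base => exact le_rfl
    | succ q hpq ih =>
      have h1 := ih (by omega)
      have h2 : f ⟨q, by omega⟩ < f ⟨q + 1, hq⟩ := f.strictMono (by simp [Fin.lt_def])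
      omega
  have hge : ∀ p (hp : p < N), p ≤ f ⟨p, hp⟩ := by
    intro p hp
    have := hmono 0 p (by omega) hp (Nat.zero_le p)
    omega
  let row : ℕ → ℕ := fun i =>
    if h : i < N then f ⟨N - 1 - i, by omega⟩ - (N - 1 - i) else 0
  have hrow : ∀ i j, i ≤ j → row j ≤ row i := by
    intro i j hij
    by_cases hj : j < N
    · have := hmono (N - 1 - j) (N - 1 - i) (by omega) (by omega) (by omega)
      simp only [row, hj, show i < N by omega, dif_pos]
      omega
    · simp [row, hj]
  let Y : YoungDiagram :=
    { cells := (range N).sigma (fun i => range (row i)) |>.map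
        (Equiv.sigmaEquivProd ℕ ℕ).toEmbedding
      isLowerSet := by
        rintro ⟨i, j⟩ ⟨i', j'⟩ ⟨h1, h2⟩ h
        simp only [coe_map, Set.mem_image, mem_coe, mem_sigma, mem_range] at h ⊢
        obtain ⟨⟨a, c⟩, ⟨ha, hc⟩, he⟩ := h
        simp only [Equiv.coe_toEmbedding, Equiv.sigmaEquivProd_apply, Prod.mk.injEq] at he
        obtain ⟨rfl, rfl⟩ := he
        simp only at h1 h2 ha hc
        have := hrow _ _ h1
        exact ⟨⟨i', j'⟩, ⟨by simp only; omega, by simp only; omega⟩, rfl⟩ }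
  have hmem : ∀ i j, (i, j) ∈ Y ↔ i < N ∧ j < row i := by
    intro i j
    rw [← mem_cells]
    simp only [Y, mem_map, mem_sigma, mem_range, Sigma.exists, Equiv.coe_toEmbedding,
      Equiv.sigmaEquivProd_apply, Prod.mk.injEq]
    constructor
    · rintro ⟨a, c, h, rfl, rfl⟩
      exact h
    · intro h
      exact ⟨i, j, h, rfl, rfl⟩
  have hlen : ∀ i < N, Y.rowLen i = row i := by
    intro i hi
    refine eq_of_forall_lt_iff fun j => ?_
    rw [← mem_iff_lt_rowLen, hmem]
    simp [hi]
  refine ⟨Y, ?_, ?_⟩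
  · by_contra h
    have h1 : (N, 0) ∈ Y := mem_iff_lt_colLen.2 (by omega)
    rw [hmem] at h1
    omega
  · refine eq_of_subset_of_card_le ?_ (by rw [card_betaSet])
    intro x hx
    obtain ⟨i, hi, rfl⟩ := mem_betaSet.1 hx
    rw [hlen i hi]
    have := hge (N - 1 - i) (by omega)
    simp only [row, hi, dif_pos]
    rw [Nat.sub_add_cancel this]
    exact X.orderEmbOfFin_mem hNdef.symm _

end YoungDiagram

/-- If `X` consists of the naturals below the threshold `b` of their residue class modulo `s`,
then `X + s` together with `{0, …, s - 1}` is `X` together with the thresholds. -/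
theorem sum_shift_of_threshold {s : ℕ} [NeZero s] {X : Finset ℕ} {b : ZMod s → ℕ}
    (hb : ∀ c, (b c : ZMod s) = c) (hX : ∀ x : ℕ, x ∈ X ↔ x < b x) (g : ℕ → ℤ) :
    ∑ x ∈ X, g (x + s) + ∑ x ∈ range s, g x = ∑ x ∈ X, g x + ∑ c, g (b c) := by
  have hs : 0 < s := Nat.pos_of_ne_zero (NeZero.ne s)
  have hinj : Function.Injective b := fun c d h => by rw [← hb c, h, hb d]
  have h1 : ∑ x ∈ X, g (x + s) = ∑ x ∈ X.map (addRightEmbedding s), g x := by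
    simp [sum_map]
  have h2 : ∑ c, g (b c) = ∑ x ∈ univ.map ⟨b, hinj⟩, g x := by
    simp [sum_map]
  have hd1 : Disjoint (X.map (addRightEmbedding s)) (range s) := by
    rw [disjoint_left]
    intro x hx hx'
    simp only [mem_map, addRightEmbedding_apply, mem_range] at hx hx'
    obtain ⟨y, -, rfl⟩ := hx
    omega
  have hd2 : Disjoint X (univ.map ⟨b, hinj⟩) := by
    rw [disjoint_left]
    intro x hx hx'
    simp only [mem_map, mem_univ, true_and, Function.Embedding.coeFn_mk] at hx'
    obtain ⟨c, rfl⟩ := hx'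
    rw [hX, hb] at hx
    exact lt_irrefl _ hx
  rw [h1, h2, ← sum_union hd1, ← sum_union hd2]
  refine sum_congr ?_ fun _ _ => rfl
  ext y
  have hmod : b y ≡ y [MOD s] := (ZMod.natCast_eq_natCast_iff _ _ _).1 (hb y)
  have hright : y ∈ X ∪ univ.map ⟨b, hinj⟩ ↔ y ≤ b y := by
    simp only [mem_union, hX, mem_map, mem_univ, true_and, Function.Embedding.coeFn_mk]
    constructor
    · rintro (h | ⟨c, rfl⟩)
      · exact h.le
      · rw [hb]
    · intro h
      rcases h.lt_or_eq with h | h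
      · exact Or.inl h
      · exact Or.inr ⟨y, h.symm⟩
  have hleft : y ∈ X.map (addRightEmbedding s) ∪ range s ↔ y < b y + s := by
    simp only [mem_union, mem_map, addRightEmbedding_apply, mem_range]
    constructor
    · rintro (⟨x, hx, rfl⟩ | h)
      · rw [hX] at hx
        simpa using hx
      · omega
    · intro h
      by_cases hy : y < s
      · exact Or.inr hy
      · refine Or.inl ⟨y - s, ?_, by omega⟩
        rw [hX, Nat.cast_sub (by omega), ZMod.natCast_self, sub_zero]
        omega
  rw [hleft, hright]
  constructor
  · intro h
    by_contra hlt
    have := (Nat.modEq_iff_dvd' (by omega)).1 hmod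
    have := Nat.le_of_dvd (by omega) this
    omega
  · omega

theorem sum_range_id_int (s : ℕ) : 2 * ∑ i ∈ range s, (i : ℤ) = s * (s - 1) := by
  induction s with
  | zero => simp
  | succ n ih => rw [sum_range_succ, mul_add, ih]; push_cast; ring

theorem sum_range_sq_int (s : ℕ) :
    6 * ∑ i ∈ range s, (i : ℤ) ^ 2 = s * (s - 1) * (2 * s - 1) := by
  induction s with
  | zero => simp
  | succ n ih => rw [sum_range_succ, mul_add, ih]; push_cast; ring

/-- The size of an `s`-core in terms of the thresholds of its beta-set. -/
theorem card_of_threshold {s : ℕ} [NeZero s] {Y : YoungDiagram} {N : ℕ} (hN : Y.colLen 0 ≤ N)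
    {b : ZMod s → ℕ} (hb : ∀ c, (b c : ZMod s) = c)
    (hX : ∀ x : ℕ, x ∈ Y.betaSet N ↔ x < b x) :
    (24 * s ^ 2 * Y.card : ℤ) =
      12 * (s * ∑ c, (b c : ℤ) ^ 2 - (∑ c, (b c : ℤ)) ^ 2) - s ^ 2 * (s ^ 2 - 1) := by
  have hlin := sum_shift_of_threshold hb hX (fun x => (x : ℤ))
  have hquad := sum_shift_of_threshold hb hX (fun x => (x : ℤ) ^ 2)
  have hcard : (∑ x ∈ Y.betaSet N, (x : ℤ)) = Y.card + ∑ i ∈ range N, (i : ℤ) := by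
    rw [← Nat.cast_sum, ← Nat.cast_sum, Y.sum_betaSet hN, Nat.cast_add]
  simp only [Nat.cast_add, add_sq, sum_add_distrib, sum_const, Y.card_betaSet, nsmul_eq_mul,
    ← sum_mul, ← mul_sum, hcard] at hlin hquad
  have e1 := sum_range_id_int s
  have e2 := sum_range_sq_int s
  have e3 := sum_range_id_int N
  generalize ∑ i ∈ range s, (i : ℤ) = σ₁ at *
  generalize ∑ i ∈ range s, (i : ℤ) ^ 2 = σ₂ at *
  generalize ∑ i ∈ range N, (i : ℤ) = τ at *
  generalize ∑ c, (b c : ℤ) = A at *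
  generalize ∑ c, (b c : ℤ) ^ 2 = Q at *
  generalize ∑ x ∈ Y.betaSet N, (x : ℤ) ^ 2 = R at *
  have hA : A = s * N + σ₁ := by linarith
  have hQ : Q = 2 * (Y.card + τ) * s + N * s ^ 2 + σ₂ := by linarith
  subst hA hQ
  linear_combination (-12 * (s : ℤ) ^ 2) * e3 + (-2 * (s : ℤ)) * e2 +
    (12 * (s : ℤ) * N + 6 * σ₁ + 3 * (s : ℤ) * (s - 1)) * e1

theorem sum_zmod_val {s : ℕ} [NeZero s] (f : ℕ → ℤ) :
    ∑ m : ZMod s, f m.val = ∑ i ∈ range s, f i := by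
  refine sum_bij' (fun m _ => m.val) (fun i _ => (i : ZMod s)) ?_ ?_ ?_ ?_ ?_
  · intro m _
    simpa using ZMod.val_lt m
  · simp
  · simp
  · intro i hi
    exact ZMod.val_cast_of_lt (mem_range.1 hi)
  · simp

theorem bijective_add_mul_zmod {s t : ℕ} [NeZero s] (h : Nat.Coprime t s) (c : ZMod s) :
    Function.Bijective fun m : ZMod s => c + m * t := by
  have hu : IsUnit (t : ZMod s) := (ZMod.isUnit_iff_coprime t s).2 h
  refine Function.Injective.bijective_of_finite fun x y hxy => ?_
  exact hu.mul_left_injective (add_left_cancel hxy)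

/-- A function on `ZMod s` that increases by at most `t` along steps of size `t` has variance at
most that of an arithmetic progression of difference `t`. -/
theorem variance_le_of_step_le {s t : ℕ} [NeZero s] (h : Nat.Coprime t s) {b : ZMod s → ℤ}
    (hstep : ∀ c, b (c + t) ≤ b c + t) :
    12 * (s * ∑ c, b c ^ 2 - (∑ c, b c) ^ 2) ≤ s ^ 2 * (s ^ 2 - 1) * t ^ 2 := by
  have hiter : ∀ (m : ℕ) c, b (c + m * t) ≤ b c + m * t := by
    intro m
    induction m with
    | zero => simp
    | succ m ih =>
      intro c
      have h1 := hstep (c + m * t)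
      have h2 := ih c
      have h3 : c + ((m + 1 : ℕ) : ZMod s) * t = c + m * t + t := by push_cast; ring
      rw [h3]
      push_cast
      linarith
  have hpt : ∀ m c : ZMod s, (b (c + m * t) - b c) ^ 2 ≤
      (2 * (m.val : ℤ) - s) * t * (b (c + m * t) - b c) + m.val * (s - m.val) * t ^ 2 := by
    intro m c
    have hm : m.val ≤ s := (ZMod.val_lt m).le
    have h1 := hiter m.val c
    have h2 := hiter (s - m.val) (c + m * t)
    rw [ZMod.natCast_val, ZMod.cast_id] at h1
    rw [Nat.cast_sub hm, Nat.cast_sub hm, ZMod.natCast_self, ZMod.natCast_val, ZMod.cast_id,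
      show c + m * t + (0 - m) * (t : ZMod s) = c by ring] at h2
    nlinarith [mul_nonneg (sub_nonneg.2 h1) (sub_nonneg.2 h2)]
  have hsum : ∑ m : ZMod s, ∑ c, (b (c + m * t) - b c) ^ 2 ≤
      ∑ m : ZMod s, (s : ℤ) * (m.val * (s - m.val) * t ^ 2) := by
    refine sum_le_sum fun m _ => (sum_le_sum fun c _ => hpt m c).trans_eq ?_
    have hshift : ∑ c, b (c + m * t) = ∑ c, b c := Equiv.sum_comp (Equiv.addRight (m * t)) b
    rw [sum_add_distrib, ← mul_sum, sum_sub_distrib, hshift, sub_self, mul_zero, zero_add]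
    simp [ZMod.card]
  have hL : ∑ m : ZMod s, ∑ c, (b (c + m * t) - b c) ^ 2 =
      2 * (s * ∑ c, b c ^ 2 - (∑ c, b c) ^ 2) := by
    rw [sum_comm]
    have : ∀ c, ∑ m : ZMod s, (b (c + m * t) - b c) ^ 2 = ∑ d, (b d - b c) ^ 2 := fun c =>
      (bijective_add_mul_zmod h c).sum_comp fun d => (b d - b c) ^ 2
    rw [sum_congr rfl fun c _ => this c]
    simp only [sub_sq, sum_add_distrib, sum_sub_distrib, ← mul_sum, ← sum_mul, sum_const,
      card_univ, ZMod.card, nsmul_eq_mul]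
    ring
  have hval : ∀ f : ℕ → ℤ, ∑ m : ZMod s, f m.val = ∑ i ∈ range s, f i := sum_zmod_val
  have hR : ∑ m : ZMod s, (s : ℤ) * (m.val * (s - m.val) * t ^ 2) =
      s * t ^ 2 * (s * ∑ i ∈ range s, (i : ℤ) - ∑ i ∈ range s, (i : ℤ) ^ 2) := by
    rw [hval fun i => (s : ℤ) * (i * (s - i) * t ^ 2), mul_sum, ← sum_sub_distrib, mul_sum]
    refine sum_congr rfl fun i _ => ?_
    ring
  rw [hL, hR] at hsum
  have e1 := sum_range_id_int s
  have e2 := sum_range_sq_int s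
  generalize ∑ i ∈ range s, (i : ℤ) = σ₁ at *
  generalize ∑ i ∈ range s, (i : ℤ) ^ 2 = σ₂ at *
  have : 6 * (s * t ^ 2 * (s * σ₁ - σ₂)) = (s : ℤ) ^ 2 * (s ^ 2 - 1) * t ^ 2 := by
    linear_combination (3 * (s : ℤ) ^ 2 * t ^ 2) * e1 - (s : ℤ) * t ^ 2 * e2
  linarith

theorem exists_threshold {s : ℕ} [NeZero s] {X : Finset ℕ}
    (hX : ∀ x ∈ X, s ≤ x → x - s ∈ X) :
    ∃ b : ZMod s → ℕ, (∀ c, (b c : ZMod s) = c) ∧ ∀ x : ℕ, x ∈ X ↔ x < b x := by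
  have hs : 0 < s := Nat.pos_of_ne_zero (NeZero.ne s)
  have hex : ∀ c : ZMod s, ∃ n : ℕ, (n : ZMod s) = c ∧ n ∉ X := by
    intro c
    refine ⟨c.val + s * (X.sup id + 1), by simp, fun h => ?_⟩
    have h1 : _ ≤ X.sup id := le_sup (f := id) h
    have h2 := Nat.le_mul_of_pos_left (X.sup id + 1) hs
    simp only [id] at h1
    omega
  have hsub : ∀ m x, x + s * m ∈ X → x ∈ X := by
    intro m
    induction m with
    | zero => simp
    | succ m ih =>
      intro x hx
      refine ih x ?_
      have := hX _ hx (by rw [mul_add]; omega)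
      rwa [show x + s * (m + 1) - s = x + s * m by rw [mul_add]; omega] at this
  classical
  refine ⟨fun c => Nat.find (hex c), fun c => (Nat.find_spec (hex c)).1, fun x => ?_⟩
  obtain ⟨h1, h2⟩ := Nat.find_spec (hex x)
  constructor
  · intro hx
    by_contra hlt
    rw [not_lt] at hlt
    have hd := (Nat.modEq_iff_dvd' hlt).1 ((ZMod.natCast_eq_natCast_iff _ _ _).1 h1)
    obtain ⟨m, hm⟩ := hd
    refine h2 (hsub m _ ?_)
    rwa [← hm, Nat.add_sub_cancel' hlt]
  · intro hx
    by_contra hnot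
    exact absurd (Nat.find_min' (hex x) ⟨rfl, hnot⟩) (not_le.2 hx)

theorem YoungDiagram.card_le_of_isCore {s t : ℕ} (hs : 0 < s) (ht : 0 < t)
    (h : Nat.Coprime t s) {Y : YoungDiagram} (hYs : Y.IsCore s) (hYt : Y.IsCore t) :
    (24 * Y.card : ℤ) ≤ (s ^ 2 - 1) * (t ^ 2 - 1) := by
  have : NeZero s := ⟨hs.ne'⟩
  rw [Y.isCore_iff_betaSet le_rfl hs] at hYs
  rw [Y.isCore_iff_betaSet le_rfl ht] at hYt
  obtain ⟨b, hb, hX⟩ := exists_threshold hYs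
  have hstep : ∀ c, (b (c + t) : ℤ) ≤ b c + t := by
    intro c
    by_contra! hlt
    have hmem : b c + t ∈ Y.betaSet (Y.colLen 0) := by
      rw [hX, Nat.cast_add, hb]
      exact_mod_cast hlt
    have := hYt _ hmem (by omega)
    rw [Nat.add_sub_cancel, hX, hb] at this
    exact lt_irrefl _ this
  have hcard := card_of_threshold le_rfl hb hX
  have hvar := variance_le_of_step_le h (b := fun c => (b c : ℤ)) hstep
  have hs2 : (0 : ℤ) < (s : ℤ) ^ 2 := by positivity
  refine le_of_mul_le_mul_left ?_ hs2
  linarith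

theorem YoungDiagram.exists_isCore_card_eq {s t : ℕ} (hs : 0 < s) (ht : 0 < t)
    (h : Nat.Coprime t s) :
    ∃ Y : YoungDiagram, Y.IsCore s ∧ Y.IsCore t ∧
      (24 * Y.card : ℤ) = (s ^ 2 - 1) * (t ^ 2 - 1) := by
  have : NeZero s := ⟨hs.ne'⟩
  have hu : (t : ZMod s) * (t : ZMod s)⁻¹ = 1 := ZMod.coe_mul_inv_eq_one t h
  let b : ZMod s → ℕ := fun c => t * (c * (t : ZMod s)⁻¹).val
  have hb : ∀ c, (b c : ZMod s) = c := by
    intro c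
    simp only [b, Nat.cast_mul, ZMod.natCast_val, ZMod.cast_id]
    linear_combination c * hu
  have hbound : ∀ c, b c ≤ t * s := fun c => Nat.mul_le_mul_left t (ZMod.val_lt _).le
  let X : Finset ℕ := (range (t * s)).filter fun x => x < b x
  have hX : ∀ x : ℕ, x ∈ X ↔ x < b x := by
    intro x
    simp only [X, mem_filter, mem_range, and_iff_right_iff_imp]
    exact fun hx => hx.trans_le (hbound x)
  obtain ⟨Y, hN, hY⟩ := YoungDiagram.exists_betaSet_eq X
  refine ⟨Y, ?_, ?_, ?_⟩
  · rw [Y.isCore_iff_betaSet hN hs, hY]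
    intro x hx hsx
    rw [hX] at hx ⊢
    rw [Nat.cast_sub hsx, ZMod.natCast_self, sub_zero]
    omega
  · rw [Y.isCore_iff_betaSet hN ht, hY]
    intro x hx htx
    rw [hX] at hx ⊢
    have hle : b x ≤ b ((x : ZMod s) - (t : ZMod s)) + t := by
      have h1 := ZMod.val_add_le (((x : ZMod s) - (t : ZMod s)) * (t : ZMod s)⁻¹) 1
      have h2 : ((x : ZMod s) - (t : ZMod s)) * (t : ZMod s)⁻¹ + 1 = x * (t : ZMod s)⁻¹ := by
        linear_combination -hu
      have h3 : (1 : ZMod s).val ≤ 1 := by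
        have := ZMod.val_natCast s 1
        rw [Nat.cast_one] at this
        rw [this]
        exact Nat.mod_le 1 s
      rw [h2] at h1
      calc b x ≤ t * ((((x : ZMod s) - (t : ZMod s)) * (t : ZMod s)⁻¹).val + 1) :=
            Nat.mul_le_mul_left t (h1.trans (Nat.add_le_add_left h3 _))
        _ = _ := by simp only [b]; ring
    rw [Nat.cast_sub htx]
    omega
  · have hcard := card_of_threshold hN hb (by rwa [hY])
    have hsum : ∀ f : ℕ → ℤ, ∑ c, f (b c) = ∑ i ∈ range s, f (t * i) := by
      intro f
      have hbij : Function.Bijective fun c : ZMod s => c * (t : ZMod s)⁻¹ :=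
        Function.Injective.bijective_of_finite fun x y hxy => by
          change x * (t : ZMod s)⁻¹ = y * (t : ZMod s)⁻¹ at hxy
          linear_combination (t : ZMod s) * hxy - (x - y) * hu
      rw [← sum_zmod_val fun i => f (t * i)]
      exact hbij.sum_comp fun c => f (t * c.val)
    rw [hsum fun x => (x : ℤ) ^ 2, hsum fun x => (x : ℤ)] at hcard
    simp only [Nat.cast_mul, mul_pow, ← mul_sum] at hcard
    have e1 := sum_range_id_int s
    have e2 := sum_range_sq_int s
    generalize ∑ i ∈ range s, (i : ℤ) = σ₁ at *
    generalize ∑ i ∈ range s, (i : ℤ) ^ 2 = σ₂ at *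
    have hs2 : (s : ℤ) ^ 2 ≠ 0 := by positivity
    refine mul_left_cancel₀ hs2 ?_
    linear_combination hcard + 2 * (s : ℤ) * t ^ 2 * e2 -
      (t : ℤ) ^ 2 * (6 * σ₁ + 3 * s * (s - 1)) * e1

theorem max_size_two_cores (k : ℕ) (hk : 1 ≤ k) :
    IsGreatest {n : ℕ | ∃ Y : YoungDiagram,
        Y.IsCore (2 * k - 1) ∧ Y.IsCore (2 * k + 1) ∧ Y.card = n}
      (4 * k ^ 2 * (k + 1) * (k - 1) / 6) := by
  have hcop : Nat.Coprime (2 * k + 1) (2 * k - 1) := by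
    have h2 : Nat.Coprime 2 (2 * k - 1) :=
      Nat.coprime_two_left.2 ⟨k - 1, by omega⟩
    rw [show 2 * k + 1 = 2 + (2 * k - 1) by omega]
    exact Nat.coprime_add_self_left.2 h2
  have hval : (((2 * k - 1 : ℕ) : ℤ) ^ 2 - 1) * (((2 * k + 1 : ℕ) : ℤ) ^ 2 - 1) =
      4 * (4 * k ^ 2 * (k + 1) * (k - 1) : ℕ) := by
    push_cast [Nat.cast_sub hk, Nat.cast_sub (show 1 ≤ 2 * k by omega)]
    ring
  constructor
  · obtain ⟨Y, hs, ht, hY⟩ := YoungDiagram.exists_isCore_card_eq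
      (show 0 < 2 * k - 1 by omega) (show 0 < 2 * k + 1 by omega) hcop
    rw [hval] at hY
    refine ⟨Y, hs, ht, ?_⟩
    omega
  · rintro n ⟨Y, hs, ht, rfl⟩
    have hY := YoungDiagram.card_le_of_isCore (by omega) (by omega) hcop hs ht
    rw [hval] at hY
    omega
end

section
/- For every integer k ≥ 1, the maximum of the sizes of all simultaneous (2k−1, 2k+1)-core partitions equals 4 times the maximum of the sizes of all simultaneous (2k−1, 2k, 2k+1)-core partitions. -/
/-- The beta-set of a Young diagram, read off from its first `n` rows. -/
def YoungDiagram.betaSet_s3 (Y : YoungDiagram) (n : ℕ) : Finset ℕ :=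
  (Finset.range n).image fun i => Y.rowLen i + (n - 1 - i)

theorem YoungDiagram.mem_betaSet_s3 {Y : YoungDiagram} {n x : ℕ} :
    x ∈ Y.betaSet_s3 n ↔ ∃ i < n, Y.rowLen i + (n - 1 - i) = x := by
  simp [YoungDiagram.betaSet_s3]

theorem YoungDiagram.betaSet_injOn_s3 (Y : YoungDiagram) (n : ℕ) :
    Set.InjOn (fun i => Y.rowLen i + (n - 1 - i)) (Finset.range n) := by
  intro i hi j hj h
  simp only [Finset.coe_range, Set.mem_Iio] at hi hj h
  rcases lt_trichotomy i j with hij | hij | hij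
  · have := Y.rowLen_anti i j hij.le
    omega
  · exact hij
  · have := Y.rowLen_anti j i hij.le
    omega

theorem YoungDiagram.card_betaSet_s3 (Y : YoungDiagram) (n : ℕ) : (Y.betaSet_s3 n).card = n := by
  rw [YoungDiagram.betaSet_s3, Finset.card_image_of_injOn (Y.betaSet_injOn_s3 n), Finset.card_range]

theorem YoungDiagram.card_eq_sum_rowLen_s3 (Y : YoungDiagram) {n : ℕ} (hn : Y.rowLen n = 0) :
    Y.card = ∑ i ∈ Finset.range n, Y.rowLen i := by
  have h : ∀ c ∈ Y.cells, c.1 ∈ Finset.range n := by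
    rintro ⟨i, j⟩ hc
    rw [YoungDiagram.mem_cells, YoungDiagram.mem_iff_lt_rowLen] at hc
    rw [Finset.mem_range]
    by_contra hin
    have := Y.rowLen_anti n i (by simpa using hin)
    omega
  rw [YoungDiagram.card, Finset.card_eq_sum_card_fiberwise h]
  refine Finset.sum_congr rfl fun i _ => ?_
  rw [YoungDiagram.rowLen_eq_card]
  rfl

theorem YoungDiagram.sum_betaSet_s3 (Y : YoungDiagram) {n : ℕ} (hn : Y.rowLen n = 0) :
    2 * ∑ x ∈ Y.betaSet_s3 n, (x : ℤ) = 2 * (Y.card : ℤ) + n * (n - 1) := by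
  rw [YoungDiagram.betaSet_s3, Finset.sum_image (Y.betaSet_injOn_s3 n), Y.card_eq_sum_rowLen_s3 hn]
  push_cast
  rw [Finset.sum_add_distrib, Finset.sum_range_reflect (fun i => (i : ℤ)) n]
  have : 2 * ∑ i ∈ Finset.range n, (i : ℤ) = n * (n - 1) := by
    clear hn
    induction n with
    | zero => simp
    | succ n ih => rw [Finset.sum_range_succ, mul_add, ih]; push_cast; ring
  linarith

theorem YoungDiagram.isCore_iff_betaSet_s3 (Y : YoungDiagram) {n t : ℕ} (hn : Y.rowLen n = 0)
    (ht : 0 < t) :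
    Y.IsCore t ↔ ∀ x ∈ Y.betaSet_s3 n, t ≤ x → x - t ∈ Y.betaSet_s3 n := by
  constructor
  · intro hcore x hx htx
    obtain ⟨i, hi, rfl⟩ := YoungDiagram.mem_betaSet_s3.1 hx
    by_contra hy
    obtain ⟨y, hyx⟩ : ∃ y, y + t = Y.rowLen i + (n - 1 - i) := ⟨_, Nat.sub_add_cancel htx⟩
    rw [← hyx, Nat.add_sub_cancel] at hy
    have hex : ∃ p, n ≤ p ∨ Y.rowLen p + (n - 1 - p) ≤ y := ⟨n, Or.inl le_rfl⟩
    obtain ⟨p, hp, hmin⟩ : ∃ p, (n ≤ p ∨ Y.rowLen p + (n - 1 - p) ≤ y) ∧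
        ∀ q < p, ¬ (n ≤ q ∨ Y.rowLen q + (n - 1 - q) ≤ y) :=
      ⟨Nat.find hex, Nat.find_spec hex, fun q hq => Nat.find_min hex hq⟩
    have hip : i < p := by
      by_contra hpi
      rcases hp with hp | hp
      · omega
      · have := Y.rowLen_anti p i (by omega)
        omega
    have hprev := hmin (p - 1) (by omega)
    have hrow : Y.rowLen p ≤ y + p - n ∧ n ≤ y + p := by
      rcases hp with hp | hp
      · have := Y.rowLen_anti n p hp
        omega
      · by_cases hpn : p < n
        · have : Y.rowLen p + (n - 1 - p) ≠ y := fun h =>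
            hy (YoungDiagram.mem_betaSet_s3.2 ⟨p, hpn, h⟩)
          omega
        · have := Y.rowLen_anti n p (by omega)
          omega
    have hcol : Y.colLen (y + p - n) = p := by
      apply le_antisymm
      · by_contra h
        have := YoungDiagram.mem_iff_lt_rowLen.1
          (YoungDiagram.mem_iff_lt_colLen.2 (not_le.1 h))
        omega
      · have : p - 1 < Y.colLen (y + p - n) :=
          YoungDiagram.mem_iff_lt_colLen.1 (YoungDiagram.mem_iff_lt_rowLen.2 (by omega))
        omega
    have hmem : (i, y + p - n) ∈ Y := YoungDiagram.mem_iff_lt_colLen.2 (by omega)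
    apply hcore _ ((YoungDiagram.mem_cells _).2 hmem)
    have := YoungDiagram.mem_iff_lt_rowLen.1 hmem
    simp only [YoungDiagram.hookLength, hcol]
    omega
  · rintro h ⟨i, j⟩ hc hhook
    rw [YoungDiagram.mem_cells] at hc
    have hrow := YoungDiagram.mem_iff_lt_rowLen.1 hc
    have hcol := YoungDiagram.mem_iff_lt_colLen.1 hc
    simp only [YoungDiagram.hookLength] at hhook
    have hpn : Y.colLen j ≤ n := by
      by_contra hlt
      have := YoungDiagram.mem_iff_lt_rowLen.1 (YoungDiagram.mem_iff_lt_colLen.2 (not_le.1 hlt))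
      omega
    have hy := h _ (YoungDiagram.mem_betaSet_s3.2 ⟨i, by omega, rfl⟩) (by omega)
    obtain ⟨i', hi', he⟩ := YoungDiagram.mem_betaSet_s3.1 hy
    rcases lt_or_ge i' (Y.colLen j) with hlt | hge
    · have := YoungDiagram.mem_iff_lt_rowLen.1 (YoungDiagram.mem_iff_lt_colLen.2 hlt)
      omega
    · have : ¬ j < Y.rowLen i' := fun hlt => by
        have := YoungDiagram.mem_iff_lt_colLen.1 (YoungDiagram.mem_iff_lt_rowLen.2 hlt)
        omega
      omega

theorem YoungDiagram.exists_rowLen_eq {r : ℕ → ℕ} (hr : Antitone r) {n : ℕ} (hn : r n = 0) :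
    ∃ Y : YoungDiagram, ∀ i, Y.rowLen i = r i := by
  let Y : YoungDiagram :=
    { cells := (Finset.range n ×ˢ Finset.range (r 0)).filter fun c => c.2 < r c.1
      isLowerSet := by
        rintro ⟨i, j⟩ ⟨i', j'⟩ ⟨hi, hj⟩ hc
        simp only [Finset.coe_filter, Finset.mem_product, Finset.mem_range,
          Set.mem_ofPred_eq] at hc hi hj ⊢
        have := hr hi
        omega }
  have hY : ∀ i j, (i, j) ∈ Y ↔ j < r i := by
    intro i j
    rw [← YoungDiagram.mem_cells]
    simp only [Y, Finset.mem_filter, Finset.mem_product, Finset.mem_range]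
    refine ⟨fun h => h.2, fun h => ⟨⟨?_, ?_⟩, h⟩⟩
    · by_contra hni
      have := hr (not_lt.1 hni)
      omega
    · have := hr (Nat.zero_le i)
      omega
  refine ⟨Y, fun i => eq_of_forall_lt_iff fun j => ?_⟩
  rw [← YoungDiagram.mem_iff_lt_rowLen, hY]

theorem YoungDiagram.exists_betaSet_eq_s3 (X : Finset ℕ) :
    ∃ Y : YoungDiagram, Y.rowLen X.card = 0 ∧ Y.betaSet_s3 X.card = X := by
  obtain ⟨n, hn⟩ : ∃ n, X.card = n := ⟨_, rfl⟩
  rw [hn]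
  let f := X.orderEmbOfFin hn
  have hf : ∀ m (h : m < n), m ≤ f ⟨m, h⟩ := by
    intro m
    induction m with
    | zero => intro h; exact Nat.zero_le _
    | succ m ih =>
      intro h
      have h1 := ih (by omega)
      have h2 : f ⟨m, by omega⟩ < f ⟨m + 1, h⟩ := f.strictMono (Nat.lt_succ_self m)
      omega
  let r : ℕ → ℕ := fun i => if h : i < n then f ⟨n - 1 - i, by omega⟩ - (n - 1 - i) else 0
  have hr : ∀ i (h : i < n), r i + (n - 1 - i) = f ⟨n - 1 - i, by omega⟩ := by
    intro i h
    simp only [r, dif_pos h]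
    exact Nat.sub_add_cancel (hf _ _)
  have hrn : r n = 0 := by simp [r]
  have hanti : Antitone r := by
    refine antitone_nat_of_succ_le fun i => ?_
    by_cases h : i + 1 < n
    · have h1 := hr i (by omega)
      have h2 := hr (i + 1) h
      have h3 : f ⟨n - 1 - (i + 1), by omega⟩ < f ⟨n - 1 - i, by omega⟩ :=
        f.strictMono (by simp only [Fin.mk_lt_mk]; omega)
      omega
    · simp [r, h]
  obtain ⟨Y, hY⟩ := YoungDiagram.exists_rowLen_eq hanti hrn
  refine ⟨Y, by rw [hY, hrn], ?_⟩
  apply Finset.eq_of_subset_of_card_le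
  · intro x hx
    obtain ⟨i, hi, rfl⟩ := YoungDiagram.mem_betaSet_s3.1 hx
    rw [hY, hr i hi]
    exact X.orderEmbOfFin_mem hn _
  · rw [YoungDiagram.card_betaSet_s3, hn]

theorem exists_residue_heights {X : Finset ℕ} {a : ℕ} (ha : 0 < a)
    (hX : ∀ x ∈ X, a ≤ x → x - a ∈ X) :
    ∃ H : ℕ → ℕ, ∀ x, x ∈ X ↔ x / a < H (x % a) := by
  have hex : ∀ ρ, ∃ u, a * u + ρ ∉ X := by
    intro ρ
    refine ⟨X.sup id + 1, fun h => ?_⟩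
    have h1 : a * (X.sup id + 1) + ρ ≤ X.sup id := Finset.le_sup (f := id) h
    nlinarith
  refine ⟨fun ρ => Nat.find (hex ρ), fun x => ?_⟩
  have hdown : ∀ ρ u d, a * (u + d) + ρ ∈ X → a * u + ρ ∈ X := by
    intro ρ u d
    induction d with
    | zero => exact id
    | succ d ih =>
      intro h
      apply ih
      have := hX _ h (by nlinarith)
      convert this using 1
      rw [← add_assoc, mul_add a (u + d), mul_one]
      omega
  constructor
  · intro hx
    by_contra hlt
    obtain ⟨d, hd⟩ := Nat.exists_eq_add_of_le (not_lt.1 hlt)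
    apply Nat.find_spec (hex (x % a))
    apply hdown _ _ d
    rw [← hd, Nat.div_add_mod]
    exact hx
  · intro hlt
    have := Nat.find_min (hex (x % a)) hlt
    rwa [Nat.div_add_mod, not_not] at this

theorem exists_finset_of_heights {a : ℕ} (ha : 0 < a) (H : ℕ → ℕ) :
    ∃ X : Finset ℕ, ∀ x, x ∈ X ↔ x / a < H (x % a) := by
  refine ⟨((Finset.range a).sigma fun ρ => Finset.range (H ρ)).image fun p => a * p.2 + p.1,
    fun x => ?_⟩
  simp only [Finset.mem_image, Finset.mem_sigma, Finset.mem_range]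
  constructor
  · rintro ⟨⟨ρ, u⟩, ⟨hρ, hu⟩, rfl⟩
    simpa [Nat.mul_add_div ha, Nat.mul_add_mod, Nat.div_eq_of_lt hρ, Nat.mod_eq_of_lt hρ] using hu
  · intro h
    exact ⟨⟨x % a, x / a⟩, ⟨Nat.mod_lt _ ha, h⟩, Nat.div_add_mod x a⟩

theorem sum_eq_sum_heights {X : Finset ℕ} {a : ℕ} (ha : 0 < a) {H : ℕ → ℕ}
    (hX : ∀ x, x ∈ X ↔ x / a < H (x % a)) (f : ℕ → ℤ) :
    ∑ x ∈ X, f x = ∑ ρ ∈ Finset.range a, ∑ u ∈ Finset.range (H ρ), f (a * u + ρ) := by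
  rw [Finset.sum_sigma']
  refine Finset.sum_bij' (fun x _ => ⟨x % a, x / a⟩) (fun p _ => a * p.2 + p.1) ?_ ?_ ?_ ?_ ?_
  · intro x hx
    simpa [Nat.mod_lt _ ha] using (hX x).1 hx
  · rintro ⟨ρ, u⟩ h
    simp only [Finset.mem_sigma, Finset.mem_range] at h
    obtain ⟨hρ, hu⟩ := h
    rw [hX]
    simpa [Nat.mul_add_div ha, Nat.mul_add_mod, Nat.div_eq_of_lt hρ, Nat.mod_eq_of_lt hρ] using hu
  · intro x _
    exact Nat.div_add_mod x a
  · rintro ⟨ρ, u⟩ h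
    simp only [Finset.mem_sigma, Finset.mem_range] at h
    simp [Nat.mul_add_div ha, Nat.div_eq_of_lt h.1, Nat.mod_eq_of_lt h.1]
  · intro x _
    rw [Nat.div_add_mod]

theorem card_eq_sum_heights {X : Finset ℕ} {a : ℕ} (ha : 0 < a) {H : ℕ → ℕ}
    (hX : ∀ x, x ∈ X ↔ x / a < H (x % a)) :
    (X.card : ℤ) = ∑ ρ ∈ Finset.range a, (H ρ : ℤ) := by
  have := sum_eq_sum_heights ha hX fun _ => 1
  simpa using this

theorem YoungDiagram.two_mul_card_eq_sum_heights {Y : YoungDiagram} {n a : ℕ}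
    (hn : Y.rowLen n = 0) (ha : 0 < a) {H : ℕ → ℕ}
    (hX : ∀ x, x ∈ Y.betaSet_s3 n ↔ x / a < H (x % a)) :
    2 * (Y.card : ℤ) = ∑ ρ ∈ Finset.range a, (2 * ρ * H ρ + a * H ρ * (H ρ - 1) : ℤ)
      - (∑ ρ ∈ Finset.range a, (H ρ : ℤ)) * (∑ ρ ∈ Finset.range a, (H ρ : ℤ) - 1) := by
  have h1 := Y.sum_betaSet_s3 hn
  have h2 := card_eq_sum_heights ha hX
  rw [Y.card_betaSet_s3] at h2
  have h3 : ∀ (ρ h : ℕ), 2 * ∑ u ∈ Finset.range h, ((a * u + ρ : ℕ) : ℤ)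
      = 2 * ρ * h + a * h * (h - 1) := by
    intro ρ h
    induction h with
    | zero => simp
    | succ h ih => rw [Finset.sum_range_succ, mul_add, ih]; push_cast; ring
  rw [sum_eq_sum_heights ha hX, Finset.mul_sum, Finset.sum_congr rfl fun ρ _ => h3 ρ (H ρ),
    h2] at h1
  linarith

theorem sum_sq_sub_eq (y : ℕ → ℤ) (n : ℕ) :
    ∑ j ∈ Finset.range n, ∑ i ∈ Finset.range j, (y j - y i) ^ 2
      = n * ∑ j ∈ Finset.range n, y j ^ 2 - (∑ j ∈ Finset.range n, y j) ^ 2 := by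
  induction n with
  | zero => simp
  | succ n ih =>
    have h : ∑ i ∈ Finset.range n, (y n - y i) ^ 2 = n * y n ^ 2
        - 2 * y n * ∑ i ∈ Finset.range n, y i + ∑ i ∈ Finset.range n, y i ^ 2 := by
      rw [Finset.sum_congr rfl fun i _ => sub_sq (y n) (y i), Finset.sum_add_distrib,
        Finset.sum_sub_distrib, Finset.mul_sum]
      simp
    rw [Finset.sum_range_succ, ih, h, Finset.sum_range_succ, Finset.sum_range_succ]
    push_cast
    ring

theorem sum_sub_mul_eq_zero (y : ℕ → ℤ) (a : ℕ) :
    ∑ j ∈ Finset.range a, ∑ i ∈ Finset.range j, (y j - y i) * (2 * ((j : ℤ) - i) - a) = 0 := by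
  have inner : ∀ (j : ℕ) (m : ℕ), ∑ i ∈ Finset.range m, (y j - y i) * (2 * ((j : ℤ) - i) - a)
      = y j * (m * (2 * j - a) - m * (m - 1)) - (2 * j - a) * ∑ i ∈ Finset.range m, y i
        + 2 * ∑ i ∈ Finset.range m, i * y i := by
    intro j m
    induction m with
    | zero => simp
    | succ m ih =>
      rw [Finset.sum_range_succ, ih, Finset.sum_range_succ, Finset.sum_range_succ]
      push_cast
      ring
  have outer : ∀ n : ℕ, ∑ j ∈ Finset.range n, ∑ i ∈ Finset.range j,
      (y j - y i) * (2 * ((j : ℤ) - i) - a)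
      = (a - n) * ((n - 1) * ∑ i ∈ Finset.range n, y i
        - 2 * ∑ i ∈ Finset.range n, i * y i) := by
    intro n
    induction n with
    | zero => simp
    | succ n ih =>
      rw [Finset.sum_range_succ, ih, inner, Finset.sum_range_succ, Finset.sum_range_succ]
      push_cast
      ring
  rw [outer, sub_self, zero_mul]

theorem sum_sub_mul_sub_eq (a : ℕ) :
    12 * ∑ j ∈ Finset.range a, ∑ i ∈ Finset.range j, ((j : ℤ) - i) * (a - (j - i))
      = (a : ℤ) ^ 2 * (a ^ 2 - 1) := by
  have inner : ∀ (j m : ℕ), 6 * ∑ i ∈ Finset.range m, ((j : ℤ) - i) * (a - (j - i))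
      = 6 * m * j * (a - j) + 3 * (2 * j - a) * m * (m - 1) - m * (m - 1) * (2 * m - 1) := by
    intro j m
    induction m with
    | zero => simp
    | succ m ih =>
      rw [Finset.sum_range_succ, mul_add, ih]
      push_cast
      ring
  have outer : ∀ n : ℕ, 12 * ∑ j ∈ Finset.range n, ∑ i ∈ Finset.range j,
      ((j : ℤ) - i) * (a - (j - i)) = 2 * a * (n ^ 3 - n) - n ^ 2 * (n ^ 2 - 1) := by
    intro n
    induction n with
    | zero => simp
    | succ n ih =>
      rw [Finset.sum_range_succ, mul_add, ih]
      have := inner n n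
      push_cast
      linear_combination 2 * this
  rw [outer]
  ring

/-- A periodic sequence whose steps are at most `b` has bounded variance. -/
theorem variance_le_of_step_le_s3 {y : ℕ → ℤ} {a : ℕ} {b : ℤ} (hper : ∀ j, y (j + a) = y j)
    (hstep : ∀ j, y (j + 1) ≤ y j + b) :
    12 * (a * ∑ j ∈ Finset.range a, y j ^ 2 - (∑ j ∈ Finset.range a, y j) ^ 2)
      ≤ b ^ 2 * (a ^ 2 * (a ^ 2 - 1)) := by
  have hsteps : ∀ i d : ℕ, y (i + d) ≤ y i + d * b := by
    intro i d
    induction d with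
    | zero => simp
    | succ d ih =>
      have := hstep (i + d)
      push_cast
      rw [← add_assoc]
      linarith
  have hpair : ∀ j ∈ Finset.range a, ∀ i ∈ Finset.range j, (y j - y i) ^ 2
      ≤ b ^ 2 * (((j : ℤ) - i) * (a - (j - i))) + b * ((y j - y i) * (2 * ((j : ℤ) - i) - a)) := by
    intro j hj i hi
    rw [Finset.mem_range] at hj hi
    have h1 := hsteps i (j - i)
    have h2 := hsteps j (i + a - j)
    rw [show i + (j - i) = j by omega] at h1
    rw [show j + (i + a - j) = i + a by omega, hper] at h2
    rw [Nat.cast_sub hi.le] at h1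
    rw [Nat.cast_sub (by omega)] at h2
    push_cast at h2
    nlinarith [mul_nonneg (sub_nonneg.2 h1) (sub_nonneg.2 h2)]
  have hsum := Finset.sum_le_sum fun j hj => Finset.sum_le_sum (hpair j hj)
  simp only [Finset.sum_add_distrib, ← Finset.mul_sum] at hsum
  rw [sum_sub_mul_eq_zero, sum_sq_sub_eq] at hsum
  have h := sum_sub_mul_sub_eq a
  rw [← h]
  linarith

theorem sum_range_two_mul_mod (κ : ℕ) (f : ℕ → ℤ) :
    ∑ j ∈ Finset.range (2 * κ + 1), f ((2 * j) % (2 * κ + 1))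
      = ∑ ρ ∈ Finset.range (2 * κ + 1), f ρ := by
  refine Finset.sum_bij' (fun j _ => (2 * j) % (2 * κ + 1))
    (fun ρ _ => ((κ + 1) * ρ) % (2 * κ + 1)) ?_ ?_ ?_ ?_ ?_
  · intro j _
    exact Finset.mem_range.2 (Nat.mod_lt _ (by omega))
  · intro j _
    exact Finset.mem_range.2 (Nat.mod_lt _ (by omega))
  · intro j hj
    rw [Nat.mul_mod_mod, show (κ + 1) * (2 * j) = j + (2 * κ + 1) * j by ring,
      Nat.add_mul_mod_self_left, Nat.mod_eq_of_lt (Finset.mem_range.1 hj)]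
  · intro j hj
    rw [Nat.mul_mod_mod, show 2 * ((κ + 1) * j) = j + (2 * κ + 1) * j by ring,
      Nat.add_mul_mod_self_left, Nat.mod_eq_of_lt (Finset.mem_range.1 hj)]
  · intro j _
    rfl

theorem first_gap_step_le {X : Finset ℕ} {a b : ℕ} (ha : 0 < a) {H : ℕ → ℕ}
    (hX : ∀ x, x ∈ X ↔ x / a < H (x % a)) (hb : ∀ x ∈ X, b ≤ x → x - b ∈ X)
    {ρ : ℕ} (hρ : ρ < a) :
    (ρ + b) % a + a * H ((ρ + b) % a) ≤ ρ + a * H ρ + b := by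
  obtain ⟨c, σ, hσ, hc, hσc⟩ : ∃ c σ, σ < a ∧ (ρ + b) % a = σ ∧ a * c + σ = ρ + b :=
    ⟨(ρ + b) / a, _, Nat.mod_lt _ ha, rfl, Nat.div_add_mod _ _⟩
  rw [hc]
  rcases Nat.eq_zero_or_pos (H σ) with h0 | hpos
  · rw [h0]
    have := Nat.zero_le (a * c)
    have := Nat.zero_le (a * H ρ)
    omega
  · obtain ⟨h, hh⟩ : ∃ h, H σ = h + 1 := ⟨H σ - 1, by omega⟩
    have hx : a * h + σ ∈ X := by
      rw [hX, Nat.mul_add_div ha, Nat.mul_add_mod, Nat.div_eq_of_lt hσ, Nat.mod_eq_of_lt hσ, hh]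
      omega
    rw [hh]
    rcases lt_or_ge h c with hlt | hge
    · have := Nat.mul_le_mul_left a (Nat.succ_le_of_lt hlt)
      have := Nat.zero_le (a * H ρ)
      rw [Nat.succ_eq_add_one] at *
      omega
    · obtain ⟨d, rfl⟩ := Nat.exists_eq_add_of_le hge
      have hx' := hb _ hx (by nlinarith)
      have he : a * (c + d) + σ - b = a * d + ρ := by
        rw [mul_add]
        omega
      rw [he, hX, Nat.mul_add_div ha, Nat.mul_add_mod, Nat.div_eq_of_lt hρ,
        Nat.mod_eq_of_lt hρ] at hx'
      have := Nat.mul_le_mul_left a (Nat.succ_le_of_lt hx')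
      rw [Nat.succ_eq_add_one] at this
      nlinarith

theorem YoungDiagram.IsCore.card_le_of_odd {Y : YoungDiagram} {κ : ℕ}
    (h₁ : Y.IsCore (2 * κ + 1)) (h₂ : Y.IsCore (2 * κ + 3)) :
    3 * (Y.card : ℤ) ≤ 2 * (κ + 1) ^ 2 * ((κ + 1) ^ 2 - 1) := by
  obtain ⟨n, hn⟩ : ∃ n, Y.rowLen n = 0 := ⟨Y.colLen 0, by
    by_contra h
    have := YoungDiagram.mem_iff_lt_colLen.1
      (YoungDiagram.mem_iff_lt_rowLen.2 (Nat.pos_of_ne_zero h))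
    omega⟩
  rw [Y.isCore_iff_betaSet_s3 hn (by omega)] at h₁ h₂
  obtain ⟨a, ha⟩ : ∃ a, a = 2 * κ + 1 := ⟨_, rfl⟩
  have ha0 : 0 < a := by omega
  rw [← ha] at h₁
  obtain ⟨H, hH⟩ := exists_residue_heights ha0 h₁
  have hcard := YoungDiagram.two_mul_card_eq_sum_heights hn ha0 hH
  have hvar := variance_le_of_step_le_s3 (a := a) (b := 2 * κ + 3)
    (y := fun j => (((2 * j) % a + a * H ((2 * j) % a) : ℕ) : ℤ))
    (fun j => by simp only [mul_add, mul_comm 2 a, Nat.add_mul_mod_self_left])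
    (fun j => by
      have := first_gap_step_le ha0 hH h₂ (Nat.mod_lt (2 * j) ha0)
      rw [Nat.mod_add_mod, show 2 * j + (2 * κ + 3) = 2 * (j + 1) + a by omega,
        Nat.add_mod_right] at this
      exact_mod_cast this)
  have hs1 := sum_range_two_mul_mod κ fun ρ => ((ρ + a * H ρ : ℕ) : ℤ)
  have hs2 := sum_range_two_mul_mod κ fun ρ => ((ρ + a * H ρ : ℕ) : ℤ) ^ 2
  rw [← ha] at hs1 hs2
  simp only [hs1, hs2] at hvar
  have hid1 : ∑ ρ ∈ Finset.range a, ((ρ + a * H ρ : ℕ) : ℤ)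
      = ∑ ρ ∈ Finset.range a, (ρ : ℤ) + a * ∑ ρ ∈ Finset.range a, (H ρ : ℤ) := by
    rw [Finset.mul_sum, ← Finset.sum_add_distrib]
    exact Finset.sum_congr rfl fun ρ _ => by push_cast; ring
  have hid2 : ∑ ρ ∈ Finset.range a, ((ρ + a * H ρ : ℕ) : ℤ) ^ 2
      = ∑ ρ ∈ Finset.range a, (ρ : ℤ) ^ 2
        + a * ∑ ρ ∈ Finset.range a, (2 * ρ * H ρ + a * H ρ * (H ρ - 1) : ℤ)
        + a ^ 2 * ∑ ρ ∈ Finset.range a, (H ρ : ℤ) := by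
    rw [Finset.mul_sum, Finset.mul_sum, ← Finset.sum_add_distrib, ← Finset.sum_add_distrib]
    exact Finset.sum_congr rfl fun ρ _ => by push_cast; ring
  have hg1 : ∀ m : ℕ, 2 * ∑ ρ ∈ Finset.range m, (ρ : ℤ) = m * (m - 1) := by
    intro m
    induction m with
    | zero => simp
    | succ m ih => rw [Finset.sum_range_succ, mul_add, ih]; push_cast; ring
  have hg2 : ∀ m : ℕ, 6 * ∑ ρ ∈ Finset.range m, (ρ : ℤ) ^ 2 = m * (m - 1) * (2 * m - 1) := by
    intro m
    induction m with
    | zero => simp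
    | succ m ih => rw [Finset.sum_range_succ, mul_add, ih]; push_cast; ring
  have hg1 := hg1 a
  have hg2 := hg2 a
  rw [hid1, hid2] at hvar
  generalize ∑ ρ ∈ Finset.range a, (H ρ : ℤ) = T at *
  generalize ∑ ρ ∈ Finset.range a, (2 * ρ * H ρ + a * H ρ * (H ρ - 1) : ℤ) = S at *
  generalize ∑ ρ ∈ Finset.range a, (ρ : ℤ) ^ 2 = Q at *
  generalize ∑ ρ ∈ Finset.range a, (ρ : ℤ) = P at *
  have hS : S = 2 * Y.card + T * (T - 1) := by linarith
  have haκ : (a : ℤ) = 2 * κ + 1 := by exact_mod_cast ha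
  have hscaled : (a : ℤ) ^ 2 * (24 * Y.card)
      ≤ a ^ 2 * (((2 * κ + 3) ^ 2 - 1) * (a ^ 2 - 1)) := by
    have e1 : 12 * (a * (Q + a * S + a ^ 2 * T) - (P + a * T) ^ 2)
        = a ^ 2 * (24 * Y.card) + a ^ 2 * (a ^ 2 - 1) := by
      rw [hS]
      linear_combination 2 * a * hg2 - (6 * P + 3 * a * (a - 1) + 12 * a * T) * hg1
    rw [e1] at hvar
    linarith
  have := le_of_mul_le_mul_left hscaled (by positivity)
  rw [haκ] at this
  nlinarith

theorem two_mul_sum_succ_mul_le {c : ℕ → ℤ} {r : ℕ} (hc : ∀ i j, i ≤ j → j < r → c j ≤ c i) :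
    2 * ∑ i ∈ Finset.range r, ((i : ℤ) + 1) * c i ≤ (r + 1) * ∑ i ∈ Finset.range r, c i := by
  induction r with
  | zero => simp
  | succ r ih =>
    have h1 := ih fun i j hij hj => hc i j hij (by omega)
    have h2 : ∑ i ∈ Finset.range r, c r ≤ ∑ i ∈ Finset.range r, c i :=
      Finset.sum_le_sum fun i hi => hc i r (Finset.mem_range.1 hi).le (by omega)
    rw [Finset.sum_const, Finset.card_range, nsmul_eq_mul] at h2
    rw [Finset.sum_range_succ, Finset.sum_range_succ]
    push_cast
    linarith

theorem sum_odd_mul_sq_le_sq_sum {c : ℕ → ℤ} {r : ℕ}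
    (hc : ∀ i j, i ≤ j → j < r → c j ≤ c i) (hc0 : ∀ i < r, 0 ≤ c i) :
    ∑ i ∈ Finset.range r, (2 * (i : ℤ) + 1) * c i ^ 2 ≤ (∑ i ∈ Finset.range r, c i) ^ 2 := by
  induction r with
  | zero => simp
  | succ r ih =>
    have h1 := ih (fun i j hij hj => hc i j hij (by omega)) fun i hi => hc0 i (by omega)
    have h2 : ∑ i ∈ Finset.range r, c r ≤ ∑ i ∈ Finset.range r, c i :=
      Finset.sum_le_sum fun i hi => hc i r (Finset.mem_range.1 hi).le (by omega)
    rw [Finset.sum_const, Finset.card_range, nsmul_eq_mul] at h2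
    rw [Finset.sum_range_succ, Finset.sum_range_succ]
    nlinarith [mul_le_mul_of_nonneg_left h2 (hc0 r (by omega))]

theorem Int.mul_succ_self_nonneg (x : ℤ) : 0 ≤ x * (x + 1) := by
  rcases le_or_gt 0 x with h | h
  · positivity
  · exact mul_nonneg_of_nonpos_of_nonpos h.le (by omega)

theorem row_length_quadratic_le {N : ℕ → ℤ} {r : ℕ} (k : ℕ)
    (hstep : ∀ i, i + 1 < r → N (i + 1) + 2 ≤ N i) (hpos : ∀ i < r, 0 < N i) :
    3 * ((4 * k - 2) * ∑ i ∈ Finset.range r, ((i : ℤ) + 1) * N i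
      - ∑ i ∈ Finset.range r, N i ^ 2 - (∑ i ∈ Finset.range r, N i) ^ 2)
      ≤ (k : ℤ) ^ 2 * (k ^ 2 - 1) := by
  obtain ⟨c, hNc⟩ : ∃ c : ℕ → ℤ, ∀ i, N i = 2 * ((r : ℤ) - 1 - i) + c i :=
    ⟨fun i => N i - 2 * ((r : ℤ) - 1 - i), fun i => by ring⟩
  have hc : ∀ i j, i ≤ j → j < r → c j ≤ c i := by
    intro i j hij
    induction j, hij using Nat.le_induction with
    | base => intro _; exact le_rfl
    | succ j hij ih =>
      intro hj
      have h1 := hstep j hj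
      have h2 := ih (by omega)
      rw [hNc, hNc] at h1
      push_cast at h1
      linarith
  have hc0 : ∀ i < r, 0 ≤ c i := by
    intro i hi
    have h1 := hc i (r - 1) (by omega) (by omega)
    have h2 := hpos (r - 1) (by omega)
    rw [hNc, Nat.cast_sub (by omega)] at h2
    push_cast at h2
    linarith
  have e1 : ∀ s : ℕ, 3 * ∑ i ∈ Finset.range s, ((i : ℤ) + 1) * N i
      = s * (s + 1) * (3 * (r - 1) - 2 * (s - 1))
        + 3 * ∑ i ∈ Finset.range s, ((i : ℤ) + 1) * c i := by
    intro s
    induction s with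
    | zero => simp
    | succ s ih =>
      rw [Finset.sum_range_succ, mul_add, ih, Finset.sum_range_succ, hNc]
      push_cast
      ring
  have e2 : ∀ s : ℕ, 3 * ∑ i ∈ Finset.range s, N i ^ 2
      = 2 * s * (6 * (r - 1) ^ 2 - 6 * (r - 1) * (s - 1) + (s - 1) * (2 * s - 1))
        + 12 * r * ∑ i ∈ Finset.range s, c i
        - 12 * ∑ i ∈ Finset.range s, ((i : ℤ) + 1) * c i
        + 3 * ∑ i ∈ Finset.range s, c i ^ 2 := by
    intro s
    induction s with
    | zero => simp
    | succ s ih =>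
      rw [Finset.sum_range_succ, mul_add, ih, Finset.sum_range_succ, Finset.sum_range_succ,
        Finset.sum_range_succ, hNc]
      push_cast
      ring
  have e3 : ∀ s : ℕ, ∑ i ∈ Finset.range s, N i
      = 2 * s * (r - 1) - s * (s - 1) + ∑ i ∈ Finset.range s, c i := by
    intro s
    induction s with
    | zero => simp
    | succ s ih =>
      rw [Finset.sum_range_succ, ih, Finset.sum_range_succ, hNc]
      push_cast
      ring
  have e4 : ∀ s : ℕ, 2 * ∑ i ∈ Finset.range s, ((i : ℤ) + 1) = s * (s + 1) := by
    intro s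
    induction s with
    | zero => simp
    | succ s ih => rw [Finset.sum_range_succ, mul_add, ih]; push_cast; ring
  have hW := two_mul_sum_succ_mul_le hc
  have hV := sum_odd_mul_sq_le_sq_sum hc hc0
  have hV' : ∑ i ∈ Finset.range r, (2 * (i : ℤ) + 1) * c i ^ 2
      = 2 * ∑ i ∈ Finset.range r, ((i : ℤ) + 1) * c i ^ 2 - ∑ i ∈ Finset.range r, c i ^ 2 := by
    rw [Finset.mul_sum, ← Finset.sum_sub_distrib]
    exact Finset.sum_congr rfl fun i _ => by ring
  have hT : ∑ i ∈ Finset.range r,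
      ((2 * (k : ℤ) + 1 - 2 * r) * (((i : ℤ) + 1) * c i) - ((i : ℤ) + 1) * c i ^ 2)
      ≤ ∑ i ∈ Finset.range r, ((k : ℤ) - r) * (k - r + 1) * ((i : ℤ) + 1) := by
    refine Finset.sum_le_sum fun i _ => ?_
    have := mul_nonneg (show (0 : ℤ) ≤ (i : ℤ) + 1 by positivity)
      (Int.mul_succ_self_nonneg ((k : ℤ) - r - c i))
    linarith
  rw [Finset.sum_sub_distrib, ← Finset.mul_sum, ← Finset.mul_sum] at hT
  have e1 := e1 r
  have e2 := e2 r
  have e3 := e3 r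
  have e4 := e4 r
  rw [hV'] at hV
  rw [e3]
  generalize ∑ i ∈ Finset.range r, c i = C at *
  generalize ∑ i ∈ Finset.range r, c i ^ 2 = Q at *
  generalize ∑ i ∈ Finset.range r, ((i : ℤ) + 1) * c i ^ 2 = V at *
  generalize ∑ i ∈ Finset.range r, ((i : ℤ) + 1) * c i = W at *
  generalize ∑ i ∈ Finset.range r, ((i : ℤ) + 1) * N i = A at *
  generalize ∑ i ∈ Finset.range r, N i ^ 2 = B at *
  generalize ∑ i ∈ Finset.range r, ((i : ℤ) + 1) = E at *
  have hW' := mul_le_mul_of_nonneg_left hW (show (0 : ℤ) ≤ r by positivity)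
  have hslack := mul_nonneg (Int.mul_succ_self_nonneg ((k : ℤ) - r - 1))
    (show (0 : ℤ) ≤ k * (k + 2 * r + 1) by positivity)
  linear_combination (4 * (k : ℤ) - 2) * e1 - e2 + 3 * hV + 6 * hT
    + 3 * ((k : ℤ) - r) * (k - r + 1) * e4 + 6 * hW' + hslack

theorem two_mul_sum_add_card_le {s : Finset ℕ} {m : ℕ} (hs : ∀ x ∈ s, x ≤ m) :
    2 * ∑ x ∈ s, (x : ℤ) + s.card * (s.card - 1) ≤ 2 * s.card * m := by
  induction s using Finset.induction_on_max generalizing m with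
  | empty => simp
  | insert x s hlt ih =>
    have hx : x ∉ s := fun h => lt_irrefl _ (hlt x h)
    have hm : x ≤ m := hs x (Finset.mem_insert_self _ _)
    rw [Finset.sum_insert hx, Finset.card_insert_of_notMem hx]
    push_cast
    have hxm : (x : ℤ) ≤ m := by exact_mod_cast hm
    rcases Finset.eq_empty_or_nonempty s with rfl | ⟨z, hz⟩
    · simp; linarith
    · have := ih (m := x - 1) fun y hy => by have := hlt y hy; omega
      have hzx := hlt z hz
      rw [Nat.cast_sub (by omega)] at this
      push_cast at this
      nlinarith [mul_le_mul_of_nonneg_left hxm (show (0 : ℤ) ≤ s.card + 1 by positivity)]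

/-- The residues occurring in the `u`-th block of length `2 * k` of `X`. -/
def blockResidues (X : Finset ℕ) (k u : ℕ) : Finset ℕ :=
  (Finset.range (2 * k)).filter fun ρ => 2 * k * u + ρ ∈ X

theorem mem_blockResidues {X : Finset ℕ} {k u ρ : ℕ} :
    ρ ∈ blockResidues X k u ↔ ρ < 2 * k ∧ 2 * k * u + ρ ∈ X := by
  simp [blockResidues]

section BlockResidues

variable {X : Finset ℕ} {k : ℕ}

theorem mem_blockResidues_of_succ (h : ∀ x ∈ X, 2 * k ≤ x → x - 2 * k ∈ X) {u ρ : ℕ}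
    (hρ : ρ ∈ blockResidues X k (u + 1)) : ρ ∈ blockResidues X k u := by
  rw [mem_blockResidues, mul_add, mul_one] at hρ
  have := h _ hρ.2 (by omega)
  rw [show 2 * k * u + 2 * k + ρ - 2 * k = 2 * k * u + ρ by omega] at this
  exact mem_blockResidues.2 ⟨hρ.1, this⟩

theorem blockResidues_bounds (h0 : 0 ∉ X) (h₁ : ∀ x ∈ X, 2 * k - 1 ≤ x → x - (2 * k - 1) ∈ X)
    (h₂ : ∀ x ∈ X, 2 * k ≤ x → x - 2 * k ∈ X) {u ρ : ℕ}
    (hρ : ρ ∈ blockResidues X k u) : 1 ≤ ρ ∧ ρ + u + 2 ≤ 2 * k := by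
  induction u generalizing ρ with
  | zero =>
    obtain ⟨hlt, hmem⟩ := mem_blockResidues.1 hρ
    rw [mul_zero, zero_add] at hmem
    have hne : ρ ≠ 0 := by rintro rfl; exact h0 hmem
    have hne' : ρ ≠ 2 * k - 1 := by
      rintro rfl
      have := h₁ _ hmem le_rfl
      rw [Nat.sub_self] at this
      exact h0 this
    omega
  | succ u ih =>
    have hb := ih (mem_blockResidues_of_succ h₂ hρ)
    obtain ⟨hlt, hmem⟩ := mem_blockResidues.1 hρ
    rw [mul_add, mul_one] at hmem
    have := h₁ _ hmem (by omega)
    rw [show 2 * k * u + 2 * k + ρ - (2 * k - 1) = 2 * k * u + (ρ + 1) by omega] at this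
    have := ih (mem_blockResidues.2 ⟨by omega, this⟩)
    omega

theorem card_blockResidues_succ_add_two_le (h0 : 0 ∉ X)
    (h₁ : ∀ x ∈ X, 2 * k - 1 ≤ x → x - (2 * k - 1) ∈ X)
    (h₂ : ∀ x ∈ X, 2 * k ≤ x → x - 2 * k ∈ X)
    (h₃ : ∀ x ∈ X, 2 * k + 1 ≤ x → x - (2 * k + 1) ∈ X) {u : ℕ}
    (hne : (blockResidues X k (u + 1)).Nonempty) :
    (blockResidues X k (u + 1)).card + 2 ≤ (blockResidues X k u).card := by
  set A := blockResidues X k (u + 1) with hA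
  have hmax := A.max'_mem hne
  have hmin := A.min'_mem hne
  have hminb := blockResidues_bounds h0 h₁ h₂ hmin
  have hmaxb := blockResidues_bounds h0 h₁ h₂ hmax
  have hle := A.min'_le _ hmax
  have hn1 : A.max' hne + 1 ∉ A := fun h => by
    have := A.le_max' _ h
    omega
  have hn2 : A.min' hne - 1 ∉ insert (A.max' hne + 1) A := fun h => by
    rcases Finset.mem_insert.1 h with h | h
    · omega
    · have := A.min'_le _ h
      omega
  have hsub : insert (A.min' hne - 1) (insert (A.max' hne + 1) A) ⊆ blockResidues X k u := by
    intro ρ hρ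
    rcases Finset.mem_insert.1 hρ with rfl | hρ
    · obtain ⟨hlt, hmem⟩ := mem_blockResidues.1 hmin
      rw [mul_add, mul_one] at hmem
      have := h₃ _ hmem (by omega)
      refine mem_blockResidues.2 ⟨by omega, ?_⟩
      convert this using 1
      omega
    · rcases Finset.mem_insert.1 hρ with rfl | hρ
      · obtain ⟨hlt, hmem⟩ := mem_blockResidues.1 hmax
        rw [mul_add, mul_one] at hmem
        have := h₁ _ hmem (by omega)
        refine mem_blockResidues.2 ⟨by omega, ?_⟩
        convert this using 1
        omega
      · exact mem_blockResidues_of_succ h₂ hρ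
  have := Finset.card_le_card hsub
  rwa [Finset.card_insert_of_notMem hn2, Finset.card_insert_of_notMem hn1] at this

theorem exists_blockResidues_rows (hk : 0 < k) (h₂ : ∀ x ∈ X, 2 * k ≤ x → x - 2 * k ∈ X) :
    ∃ r, (∀ u < r, (blockResidues X k u).Nonempty) ∧ ∀ f : ℕ → ℤ,
      ∑ x ∈ X, f x = ∑ u ∈ Finset.range r, ∑ ρ ∈ blockResidues X k u, f (2 * k * u + ρ) := by
  have hex : ∃ u, blockResidues X k u = ∅ := by
    refine ⟨X.sup id + 1, Finset.eq_empty_of_forall_notMem fun ρ hρ => ?_⟩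
    have h1 : 2 * k * (X.sup id + 1) + ρ ≤ X.sup id :=
      Finset.le_sup (f := id) (mem_blockResidues.1 hρ).2
    nlinarith
  obtain ⟨r, hr, hmin⟩ : ∃ r, blockResidues X k r = ∅ ∧ ∀ u < r, blockResidues X k u ≠ ∅ :=
    ⟨Nat.find hex, Nat.find_spec hex, fun u hu => Nat.find_min hex hu⟩
  have hempty : ∀ d, blockResidues X k (r + d) = ∅ := by
    intro d
    induction d with
    | zero => exact hr
    | succ d ih =>
      refine Finset.eq_empty_of_forall_notMem fun ρ hρ => ?_
      have := mem_blockResidues_of_succ (u := r + d) h₂ hρ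
      rw [ih] at this
      exact Finset.notMem_empty _ this
  refine ⟨r, fun u hu => Finset.nonempty_iff_ne_empty.2 (hmin u hu), fun f => ?_⟩
  rw [Finset.sum_sigma']
  have hk2 : 0 < 2 * k := by omega
  refine Finset.sum_bij' (fun x _ => ⟨x / (2 * k), x % (2 * k)⟩)
    (fun p _ => 2 * k * p.1 + p.2) ?_ ?_ ?_ ?_ ?_
  · intro x hx
    have hmem : x % (2 * k) ∈ blockResidues X k (x / (2 * k)) :=
      mem_blockResidues.2 ⟨Nat.mod_lt _ hk2, by rwa [Nat.div_add_mod]⟩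
    rw [Finset.mem_sigma, Finset.mem_range]
    refine ⟨?_, hmem⟩
    by_contra hlt
    obtain ⟨d, hd⟩ : ∃ d, x / (2 * k) = r + d := Nat.exists_eq_add_of_le (not_lt.1 hlt)
    rw [hd, hempty] at hmem
    exact Finset.notMem_empty _ hmem
  · rintro ⟨u, ρ⟩ h
    exact (mem_blockResidues.1 (Finset.mem_sigma.1 h).2).2
  · intro x _
    exact Nat.div_add_mod x _
  · rintro ⟨u, ρ⟩ h
    have hρ := (mem_blockResidues.1 (Finset.mem_sigma.1 h).2).1
    dsimp only at hρ
    simp only [Nat.mul_add_div hk2, Nat.mul_add_mod, Nat.div_eq_of_lt hρ, Nat.mod_eq_of_lt hρ,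
      add_zero]
  · intro x _
    rw [Nat.div_add_mod]

theorem six_mul_sum_le_of_sub_mem (hk : 0 < k) (h0 : 0 ∉ X)
    (h₁ : ∀ x ∈ X, 2 * k - 1 ≤ x → x - (2 * k - 1) ∈ X)
    (h₂ : ∀ x ∈ X, 2 * k ≤ x → x - 2 * k ∈ X)
    (h₃ : ∀ x ∈ X, 2 * k + 1 ≤ x → x - (2 * k + 1) ∈ X) :
    6 * ∑ x ∈ X, (x : ℤ) ≤ 3 * (X.card * (X.card - 1)) + (k : ℤ) ^ 2 * (k ^ 2 - 1) := by
  obtain ⟨r, hne, hsum⟩ := exists_blockResidues_rows hk h₂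
  have hquad := row_length_quadratic_le (N := fun u => ((blockResidues X k u).card : ℤ))
    (r := r) k
    (fun i hi => by
      exact_mod_cast card_blockResidues_succ_add_two_le h0 h₁ h₂ h₃ (hne _ hi))
    (fun i hi => by exact_mod_cast (hne i hi).card_pos)
  have hcard : (X.card : ℤ) = ∑ u ∈ Finset.range r, ((blockResidues X k u).card : ℤ) := by
    have := hsum fun _ => 1
    simpa using this
  have hrow : ∀ u ∈ Finset.range r,
      2 * ∑ ρ ∈ blockResidues X k u, ((2 * k * u + ρ : ℕ) : ℤ)
        ≤ (4 * k - 2) * (((u : ℤ) + 1) * (blockResidues X k u).card)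
          - ((blockResidues X k u).card : ℤ) ^ 2 - (blockResidues X k u).card := by
    intro u hu
    obtain ⟨z, hz⟩ := hne u (Finset.mem_range.1 hu)
    have hzb := blockResidues_bounds h0 h₁ h₂ hz
    have hb := two_mul_sum_add_card_le (s := blockResidues X k u) (m := 2 * k - 2 - u)
      fun ρ hρ => by
        have := blockResidues_bounds h0 h₁ h₂ hρ
        omega
    rw [Nat.cast_sub (by omega), Nat.cast_sub (by omega)] at hb
    push_cast at hb ⊢
    rw [Finset.sum_add_distrib, Finset.sum_const, nsmul_eq_mul]
    nlinarith
  have hle := Finset.sum_le_sum hrow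
  rw [← Finset.mul_sum, ← hsum fun x => (x : ℤ), Finset.sum_sub_distrib,
    Finset.sum_sub_distrib, ← Finset.mul_sum, ← hcard] at hle
  rw [← hcard] at hquad
  linarith

end BlockResidues

theorem YoungDiagram.IsCore.card_le_of_consecutive {Y : YoungDiagram} {k : ℕ} (hk : 0 < k)
    (h₁ : Y.IsCore (2 * k - 1)) (h₂ : Y.IsCore (2 * k)) (h₃ : Y.IsCore (2 * k + 1)) :
    6 * (Y.card : ℤ) ≤ (k : ℤ) ^ 2 * (k ^ 2 - 1) := by
  have hlen : ∀ i, 0 < Y.rowLen i ↔ i < Y.colLen 0 := fun i => by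
    rw [← YoungDiagram.mem_iff_lt_rowLen, ← YoungDiagram.mem_iff_lt_colLen]
  have hn : Y.rowLen (Y.colLen 0) = 0 := by
    by_contra h
    exact lt_irrefl _ ((hlen _).1 (Nat.pos_of_ne_zero h))
  have h0 : 0 ∉ Y.betaSet_s3 (Y.colLen 0) := fun h => by
    obtain ⟨i, hi, he⟩ := YoungDiagram.mem_betaSet_s3.1 h
    have := (hlen i).2 hi
    omega
  rw [Y.isCore_iff_betaSet_s3 hn (by omega)] at h₁ h₂ h₃
  have h := six_mul_sum_le_of_sub_mem hk h0 h₁ h₂ h₃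
  have hs := Y.sum_betaSet_s3 hn
  rw [Y.card_betaSet_s3] at h
  linarith

theorem sub_mem_of_heights {X : Finset ℕ} {a b : ℕ} (ha : 0 < a) {H : ℕ → ℕ}
    (hX : ∀ x, x ∈ X ↔ x / a < H (x % a))
    (h : ∀ ρ < a, ∀ u < H ρ, b ≤ a * u + ρ → ∃ ρ' < a, ∃ u' < H ρ', a * u' + ρ' + b = a * u + ρ) :
    ∀ x ∈ X, b ≤ x → x - b ∈ X := by
  intro x hx hbx
  obtain ⟨ρ', hρ', u', hu', he⟩ := h (x % a) (Nat.mod_lt _ ha) (x / a) ((hX x).1 hx)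
    (by rwa [Nat.div_add_mod])
  rw [Nat.div_add_mod] at he
  rw [← he, Nat.add_sub_cancel, hX, Nat.mul_add_div ha, Nat.mul_add_mod, Nat.div_eq_of_lt hρ',
    Nat.mod_eq_of_lt hρ']
  exact hu'

theorem YoungDiagram.exists_betaSet_of_heights {a : ℕ} (ha : 0 < a) (H : ℕ → ℕ) :
    ∃ (Y : YoungDiagram) (n : ℕ), Y.rowLen n = 0 ∧
      ∀ x, x ∈ Y.betaSet_s3 n ↔ x / a < H (x % a) := by
  obtain ⟨X, hX⟩ := exists_finset_of_heights ha H
  obtain ⟨Y, hn, hY⟩ := YoungDiagram.exists_betaSet_eq_s3 X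
  exact ⟨Y, X.card, hn, by rwa [hY]⟩

theorem sum_range_two_mul_add_one (κ : ℕ) (f : ℕ → ℤ) :
    ∑ ρ ∈ Finset.range (2 * κ + 1), f ρ
      = ∑ i ∈ Finset.range κ, (f (2 * i) + f (2 * i + 1)) + f (2 * κ) := by
  induction κ with
  | zero => simp
  | succ κ ih =>
    rw [show 2 * (κ + 1) + 1 = 2 * κ + 1 + 1 + 1 by ring, Finset.sum_range_succ,
      Finset.sum_range_succ, ih, Finset.sum_range_succ, show 2 * (κ + 1) = 2 * κ + 1 + 1 by ring]
    ring

theorem sum_range_two_mul (k : ℕ) (f : ℕ → ℤ) :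
    ∑ ρ ∈ Finset.range (2 * k), f ρ
      = ∑ j ∈ Finset.range k, (f j + f (2 * k - 1 - j)) := by
  rw [two_mul, Finset.sum_range_add, Finset.sum_add_distrib,
    ← Finset.sum_range_reflect (fun j => f (k + j))]
  congr 1
  refine Finset.sum_congr rfl fun j hj => ?_
  rw [Finset.mem_range] at hj
  congr 1
  omega

theorem exists_isCore_odd_card_eq (κ : ℕ) :
    ∃ Y : YoungDiagram, Y.IsCore (2 * κ + 1) ∧ Y.IsCore (2 * κ + 3) ∧
      3 * (Y.card : ℤ) = 2 * (κ + 1) ^ 2 * ((κ + 1) ^ 2 - 1) := by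
  have ha : 0 < 2 * κ + 1 := by omega
  obtain ⟨H, hHeven, hHodd⟩ : ∃ H : ℕ → ℕ, (∀ i, H (2 * i) = i) ∧
      ∀ i, H (2 * i + 1) = κ + 2 + i :=
    ⟨fun ρ => if ρ % 2 = 0 then ρ / 2 else κ + 1 + (ρ + 1) / 2,
      fun i => by dsimp only; rw [if_pos (by omega)]; omega,
      fun i => by dsimp only; rw [if_neg (by omega)]; omega⟩
  obtain ⟨Y, n, hn, hX⟩ := YoungDiagram.exists_betaSet_of_heights ha H
  refine ⟨Y, ?_, ?_, ?_⟩
  · rw [Y.isCore_iff_betaSet_s3 hn ha]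
    refine sub_mem_of_heights ha hX fun ρ hρ u hu hle => ?_
    obtain ⟨v, rfl⟩ : ∃ v, u = v + 1 :=
      Nat.exists_eq_succ_of_ne_zero (by rintro rfl; omega)
    exact ⟨ρ, hρ, v, by omega, by ring⟩
  · rw [Y.isCore_iff_betaSet_s3 hn (by omega)]
    refine sub_mem_of_heights ha hX fun ρ hρ u hu hle => ?_
    obtain ⟨v, rfl⟩ : ∃ v, u = v + 1 :=
      Nat.exists_eq_succ_of_ne_zero (by rintro rfl; omega)
    rcases Nat.even_or_odd' ρ with ⟨i, rfl | rfl⟩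
    · rw [hHeven] at hu
      obtain ⟨i, rfl⟩ : ∃ i', i = i' + 1 := ⟨i - 1, by omega⟩
      exact ⟨2 * i, by omega, v, by rw [hHeven]; omega, by ring⟩
    · rw [hHodd] at hu
      rcases i with _ | i
      · obtain ⟨v, rfl⟩ : ∃ v', v = v' + 1 :=
          Nat.exists_eq_succ_of_ne_zero (by rintro rfl; omega)
        exact ⟨2 * κ, by omega, v, by rw [hHeven]; omega, by ring⟩
      · exact ⟨2 * i + 1, by omega, v, by rw [hHodd]; omega, by ring⟩
  · have hcard := YoungDiagram.two_mul_card_eq_sum_heights hn ha hX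
    rw [sum_range_two_mul_add_one κ fun ρ => (H ρ : ℤ),
      sum_range_two_mul_add_one κ fun ρ => (2 * ρ * H ρ + (2 * κ + 1 : ℕ) * H ρ * (H ρ - 1) : ℤ)]
      at hcard
    simp only [hHeven, hHodd] at hcard
    have hT : ∀ m : ℕ, ∑ i ∈ Finset.range m, ((i : ℤ) + (κ + 2 + i : ℕ))
        = m * (m - 1) + m * (κ + 2) := by
      intro m
      induction m with
      | zero => simp
      | succ m ih => rw [Finset.sum_range_succ, ih]; push_cast; ring
    have hS : ∀ m : ℕ, 3 * ∑ i ∈ Finset.range m,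
        ((2 * (2 * i : ℕ) * i + (2 * κ + 1 : ℕ) * i * (i - 1) : ℤ)
          + (2 * (2 * i + 1 : ℕ) * (κ + 2 + i : ℕ)
            + (2 * κ + 1 : ℕ) * (κ + 2 + i : ℕ) * ((κ + 2 + i : ℕ) - 1)))
        = (2 * κ + 5) * m * (m - 1) * (2 * m - 1)
          + 3 * m * (m - 1) * (2 * κ + 5 + (2 * κ + 1) * (κ + 1))
          + 3 * m * (κ + 2) * (2 + (2 * κ + 1) * (κ + 1)) := by
      intro m
      induction m with
      | zero => simp
      | succ m ih => rw [Finset.sum_range_succ, mul_add, ih]; push_cast; ring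
    rw [hT] at hcard
    have hS := hS κ
    push_cast at hcard hS
    have : 2 * (3 * (Y.card : ℤ)) = 2 * (2 * (κ + 1) ^ 2 * ((κ + 1) ^ 2 - 1)) := by
      linear_combination 3 * hcard + hS
    linarith

theorem exists_isCore_consecutive_card_eq {k : ℕ} (hk : 0 < k) :
    ∃ Y : YoungDiagram, Y.IsCore (2 * k - 1) ∧ Y.IsCore (2 * k) ∧ Y.IsCore (2 * k + 1) ∧
      6 * (Y.card : ℤ) = (k : ℤ) ^ 2 * (k ^ 2 - 1) := by
  have ha : 0 < 2 * k := by omega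
  obtain ⟨H, hH⟩ : ∃ H : ℕ → ℕ, ∀ ρ, H ρ = min ρ (2 * k - 1 - ρ) := ⟨_, fun _ => rfl⟩
  obtain ⟨Y, n, hn, hX⟩ := YoungDiagram.exists_betaSet_of_heights ha H
  refine ⟨Y, ?_, ?_, ?_, ?_⟩
  · rw [Y.isCore_iff_betaSet_s3 hn (by omega)]
    refine sub_mem_of_heights ha hX fun ρ hρ u hu hle => ?_
    obtain ⟨v, rfl⟩ : ∃ v, u = v + 1 :=
      Nat.exists_eq_succ_of_ne_zero (by rintro rfl; rw [hH] at hu; omega)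
    rw [hH] at hu
    exact ⟨ρ + 1, by omega, v, by rw [hH]; omega, by rw [mul_add]; omega⟩
  · rw [Y.isCore_iff_betaSet_s3 hn ha]
    refine sub_mem_of_heights ha hX fun ρ hρ u hu hle => ?_
    obtain ⟨v, rfl⟩ : ∃ v, u = v + 1 :=
      Nat.exists_eq_succ_of_ne_zero (by rintro rfl; rw [hH] at hu; omega)
    rw [hH] at hu
    exact ⟨ρ, hρ, v, by rw [hH]; omega, by ring⟩
  · rw [Y.isCore_iff_betaSet_s3 hn (by omega)]
    refine sub_mem_of_heights ha hX fun ρ hρ u hu hle => ?_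
    obtain ⟨v, rfl⟩ : ∃ v, u = v + 1 :=
      Nat.exists_eq_succ_of_ne_zero (by rintro rfl; rw [hH] at hu; omega)
    rw [hH] at hu
    exact ⟨ρ - 1, by omega, v, by rw [hH]; omega, by rw [mul_add]; omega⟩
  · have hcard := YoungDiagram.two_mul_card_eq_sum_heights hn ha hX
    rw [sum_range_two_mul k fun ρ => (H ρ : ℤ),
      sum_range_two_mul k fun ρ => (2 * ρ * H ρ + (2 * k : ℕ) * H ρ * (H ρ - 1) : ℤ)] at hcard
    have e1 : ∀ j ∈ Finset.range k, ((H j : ℤ) + H (2 * k - 1 - j)) = 2 * j := by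
      intro j hj
      rw [Finset.mem_range] at hj
      rw [hH, hH]
      omega
    have e2 : ∀ j ∈ Finset.range k,
        ((2 * j * H j + (2 * k : ℕ) * H j * (H j - 1) : ℤ)
          + (2 * (2 * k - 1 - j : ℕ) * H (2 * k - 1 - j)
            + (2 * k : ℕ) * H (2 * k - 1 - j) * (H (2 * k - 1 - j) - 1)))
        = 2 * (2 * k - 1) * j + 4 * k * j * (j - 1) := by
      intro j hj
      rw [Finset.mem_range] at hj
      rw [hH, hH, show min j (2 * k - 1 - j) = j by omega,
        show min (2 * k - 1 - j) (2 * k - 1 - (2 * k - 1 - j)) = j by omega,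
        Nat.cast_sub (by omega), Nat.cast_sub (by omega)]
      push_cast
      ring
    rw [Finset.sum_congr rfl e1, Finset.sum_congr rfl e2] at hcard
    have hT : ∀ m : ℕ, ∑ j ∈ Finset.range m, (2 * (j : ℤ)) = m * (m - 1) := by
      intro m
      induction m with
      | zero => simp
      | succ m ih => rw [Finset.sum_range_succ, ih]; push_cast; ring
    have hS : ∀ m : ℕ, 3 * ∑ j ∈ Finset.range m,
        (2 * (2 * k - 1) * j + 4 * k * j * (j - 1) : ℤ)
        = 3 * (2 * k - 1) * m * (m - 1) + 4 * k * m * (m - 1) * (m - 2) := by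
      intro m
      induction m with
      | zero => simp
      | succ m ih => rw [Finset.sum_range_succ, mul_add, ih]; push_cast; ring
    rw [hT] at hcard
    linear_combination 3 * hcard + hS k

theorem max_two_eq_four_max_three (k : ℕ) (hk : 1 ≤ k) :
    ∃ M₁ M₂ : ℕ,
      IsGreatest {n : ℕ | ∃ Y : YoungDiagram,
          Y.IsCore (2 * k - 1) ∧ Y.IsCore (2 * k + 1) ∧ Y.card = n} M₁ ∧
      IsGreatest {n : ℕ | ∃ Y : YoungDiagram,
          Y.IsCore (2 * k - 1) ∧ Y.IsCore (2 * k) ∧ Y.IsCore (2 * k + 1) ∧ Y.card = n} M₂ ∧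
      M₁ = 4 * M₂ := by
  obtain ⟨Y₂, h₁, h₂, h₃, hcard₂⟩ := exists_isCore_consecutive_card_eq hk
  obtain ⟨κ, rfl⟩ : ∃ κ, k = κ + 1 := ⟨k - 1, by omega⟩
  obtain ⟨Y₁, g₁, g₂, hcard₁⟩ := exists_isCore_odd_card_eq κ
  have e₁ : 2 * (κ + 1) - 1 = 2 * κ + 1 := by omega
  have e₂ : 2 * (κ + 1) + 1 = 2 * κ + 3 := by omega
  refine ⟨Y₁.card, Y₂.card, ⟨⟨Y₁, by rwa [e₁], by rwa [e₂], rfl⟩, ?_⟩,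
    ⟨⟨Y₂, h₁, h₂, h₃, rfl⟩, ?_⟩, ?_⟩
  · rintro _ ⟨Y, f₁, f₂, rfl⟩
    rw [e₁] at f₁
    rw [e₂] at f₂
    have := f₁.card_le_of_odd f₂
    omega
  · rintro _ ⟨Y, f₁, f₂, f₃, rfl⟩
    have := YoungDiagram.IsCore.card_le_of_consecutive hk f₁ f₂ f₃
    omega
  · push_cast at hcard₂
    zify
    linarith
end

section
/- For every integer k ≥ 2, the partition whose multiset of parts consists of the squares i² with multiplicity 2k − 2i for each i = 1, 2, …, k−1 (that is, ({(k−1)²}², {(k−2)²}⁴, …, 9^{2k−6}, 4^{2k−4}, 1^{2k−2}) in exponential notation) is simultaneously a (2k−1)-core, a 2k-core, and a (2k+1)-core. -/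
theorem YoungDiagram.countP_rowLens (Y : YoungDiagram) (j : ℕ) :
    (Y.rowLens : Multiset ℕ).countP (j < ·) = Y.colLen j := by
  have h : (Finset.range (Y.colLen 0)).filter (fun i => j < Y.rowLen i) =
      Finset.range (Y.colLen j) := by
    ext i
    have h0 := Y.colLen_anti 0 j (Nat.zero_le j)
    rw [Finset.mem_filter, Finset.mem_range, Finset.mem_range, ← Y.mem_iff_lt_rowLen,
      Y.mem_iff_lt_colLen]
    omega
  have hc := congrArg Finset.card h
  rw [Finset.card_range] at hc
  rw [← hc, YoungDiagram.rowLens, ← Multiset.map_coe, Multiset.countP_map]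
  rfl

theorem sum_range_ite_two_mul_sub (p s n : ℕ) (hs : s ≤ n) (hn : n ≤ p) :
    (∑ i ∈ Finset.range n, if s ≤ i then 2 * (p - i) else 0) + (p - n) * (p - n + 1) =
      (p - s) * (p - s + 1) := by
  induction n, hs using Nat.le_induction with
  | base =>
    rw [Finset.sum_eq_zero, zero_add]
    intro i hi
    rw [Finset.mem_range] at hi
    exact if_neg (by omega)
  | succ n hsn ih =>
    rw [← ih (by omega), Finset.sum_range_succ, if_pos hsn]
    obtain ⟨q, rfl⟩ := Nat.exists_eq_add_of_le hn
    rw [show n + 1 + q - n = q + 1 by omega, show n + 1 + q - (n + 1) = q by omega]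
    ring

theorem countP_squares (p j : ℕ) (hj : Nat.sqrt j ≤ p) :
    ((Multiset.range p).bind fun i =>
        Multiset.replicate (2 * (p + 1) - 2 * (i + 1)) ((i + 1) ^ 2)).countP (j < ·) =
      (p - Nat.sqrt j) * (p - Nat.sqrt j + 1) := by
  rw [← sum_range_ite_two_mul_sub p (Nat.sqrt j) p hj le_rfl, Multiset.countP_eq_card_filter,
    Multiset.filter_bind, Multiset.card_bind, Nat.sub_self, zero_mul, add_zero]
  change _ = ((Multiset.range p).map _).sum
  congr 1
  refine Multiset.map_congr rfl fun i _ => ?_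
  have h : j < (i + 1) ^ 2 ↔ Nat.sqrt j ≤ i := by rw [← Nat.sqrt_lt', Nat.lt_succ_iff]
  rw [Function.comp_apply]
  split_ifs with hi
  · rw [Multiset.filter_eq_self.2, Multiset.card_replicate]
    · omega
    · intro a ha
      rw [Multiset.eq_of_mem_replicate ha]
      exact h.2 hi
  · rw [Multiset.filter_eq_nil.2, Multiset.card_zero]
    intro a ha
    rw [Multiset.eq_of_mem_replicate ha]
    exact mt h.1 hi

theorem squares_partition_is_core (k : ℕ) (hk : 2 ≤ k) (Y : YoungDiagram)
    (hY : (Y.rowLens : Multiset ℕ) =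
      (Multiset.range (k - 1)).bind fun i =>
        Multiset.replicate (2 * k - 2 * (i + 1)) ((i + 1) ^ 2)) :
    Y.IsCore (2 * k - 1) ∧ Y.IsCore (2 * k) ∧ Y.IsCore (2 * k + 1) := by
  obtain ⟨p, rfl⟩ : ∃ p, k = p + 1 := ⟨k - 1, by omega⟩
  rw [Nat.add_sub_cancel] at hY
  have hcol (j : ℕ) (hj : Nat.sqrt j ≤ p) :
      Y.colLen j = (p - Nat.sqrt j) * (p - Nat.sqrt j + 1) := by
    rw [← Y.countP_rowLens, hY, countP_squares p j hj]
  have key : ∀ c ∈ Y.cells, Y.hookLength c.1 c.2 < 2 * p + 1 ∨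
      2 * p + 3 < Y.hookLength c.1 c.2 := by
    rintro ⟨i, j⟩ hc
    rw [YoungDiagram.mem_cells] at hc
    have hjr := YoungDiagram.mem_iff_lt_rowLen.1 hc
    have hic := YoungDiagram.mem_iff_lt_colLen.1 hc
    have hi0 : i < Y.colLen 0 := hic.trans_le (Y.colLen_anti 0 j (Nat.zero_le j))
    have hmem : Y.rowLen i ∈ (Y.rowLens : Multiset ℕ) := by
      rw [Multiset.mem_coe, YoungDiagram.rowLens]
      exact List.mem_map_of_mem (List.mem_range.2 hi0)
    rw [hY, Multiset.mem_bind] at hmem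
    obtain ⟨r, hr, hrow⟩ := hmem
    rw [Multiset.mem_range] at hr
    replace hrow := Multiset.eq_of_mem_replicate hrow
    have hs : Nat.sqrt j ≤ r := by
      rw [hrow, ← Nat.sqrt_lt'] at hjr
      omega
    have hlow : Nat.sqrt ((r + 1) ^ 2 - 1) = r := by
      have h1 : Nat.sqrt ((r + 1) ^ 2 - 1) < r + 1 :=
        Nat.sqrt_lt'.2 (Nat.sub_lt (by positivity) one_pos)
      have h2 : r ≤ Nat.sqrt ((r + 1) ^ 2 - 1) :=
        Nat.le_sqrt'.2 (Nat.le_sub_one_of_lt (Nat.pow_lt_pow_left (Nat.lt_succ_self r) two_ne_zero))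
      omega
    have hupper : i < (p - r) * (p - r + 1) := by
      have h : (i, (r + 1) ^ 2 - 1) ∈ Y := by
        rw [YoungDiagram.mem_iff_lt_rowLen, hrow]
        exact Nat.sub_lt (by positivity) one_pos
      rwa [YoungDiagram.mem_iff_lt_colLen, hcol _ (by omega), hlow] at h
    have hlower : (p - (r + 1)) * (p - (r + 1) + 1) ≤ i := by
      have h : (i, (r + 1) ^ 2) ∉ Y := by
        rw [YoungDiagram.mem_iff_lt_rowLen, hrow]
        exact lt_irrefl _
      rwa [YoungDiagram.mem_iff_lt_colLen, hcol _ (by rw [Nat.sqrt_eq']; omega),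
        Nat.sqrt_eq', not_lt] at h
    rw [hcol j (by omega)] at hic
    rw [YoungDiagram.hookLength, hcol j (by omega), hrow]
    rw [hrow] at hjr
    have hsj := Nat.sqrt_le' j
    have hjs := Nat.lt_succ_sqrt' j
    generalize Nat.sqrt j = s at *
    obtain ⟨d, rfl⟩ := Nat.exists_eq_add_of_le hs
    obtain ⟨q, rfl⟩ := Nat.exists_eq_add_of_lt hr
    rw [show s + d + q + 1 - (s + d) = q + 1 by omega] at hupper
    rw [show s + d + q + 1 - (s + d + 1) = q by omega] at hlower
    rw [show s + d + q + 1 - s = d + q + 1 by omega] at hic ⊢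
    rw [Nat.succ_eq_add_one] at hjs
    rcases Nat.eq_zero_or_pos d with rfl | hd
    · left
      ring_nf at *
      omega
    · right
      have hds : s ≤ s * d := Nat.le_mul_of_pos_right s hd
      have hdq : q ≤ q * d := Nat.le_mul_of_pos_right q hd
      have hdd : d ≤ d * d := Nat.le_mul_of_pos_right d hd
      ring_nf at *
      omega
  refine ⟨fun c hc => ?_, fun c hc => ?_, fun c hc => ?_⟩ <;>
    have := key c hc <;> omega
end

section
/- For every integer k ≥ 2, the set S(k) = {2kj + c : 0 ≤ j ≤ k−2, j+1 ≤ c ≤ 2k−2−j} satisfies the recursion S(k) = {1, 2, …, 2k−2} ∪ {p + 2·⌊p/(2k−2)⌋ + 2k + 1 : p ∈ S(k−1)}, where S(1) is the empty set. (Equivalently: an element of S(k−1) written as p = (2k−2)j + c with 0 ≤ c ≤ 2k−3 is sent to 2k(j+1) + c + 1.) -/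
/-- The set `S(k) = {2kj + c : 0 ≤ j ≤ k−2, j+1 ≤ c ≤ 2k−2−j}`, with `S(1) = ∅`. -/
def S (k : ℕ) : Finset ℕ :=
  (Finset.range (k - 1)).biUnion fun j =>
    (Finset.Icc (j + 1) (2 * k - 2 - j)).image fun c => 2 * k * j + c

theorem mem_S {k n : ℕ} :
    n ∈ S k ↔ ∃ j < k - 1, ∃ c, (j + 1 ≤ c ∧ c ≤ 2 * k - 2 - j) ∧ 2 * k * j + c = n := by
  simp only [S, Finset.mem_biUnion, Finset.mem_range, Finset.mem_image, Finset.mem_Icc]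

/-- The recursion map sends `(2k−2)j + c` to `2k(j+1) + (c+1)` when `c < 2k−2`. -/
theorem recursion_map_apply {k j c : ℕ} (hk : 2 ≤ k) (hc : c < 2 * k - 2) :
    2 * (k - 1) * j + c + 2 * ((2 * (k - 1) * j + c) / (2 * k - 2)) + 2 * k + 1 =
      2 * k * (j + 1) + (c + 1) := by
  obtain ⟨m, rfl⟩ := Nat.exists_eq_add_of_le' hk
  have hmod : 2 * (m + 2) - 2 = 2 * (m + 1) := by omega
  have hquot : (2 * (m + 1) * j + c) / (2 * (m + 1)) = j := by
    rw [Nat.mul_add_div (by omega), Nat.div_eq_of_lt (by omega), add_zero]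
  rw [hmod, show m + 2 - 1 = m + 1 from rfl, hquot]
  ring

theorem S_recursion (k : ℕ) (hk : 2 ≤ k) :
    S k = Finset.Icc 1 (2 * k - 2) ∪
      (S (k - 1)).image fun p => p + 2 * (p / (2 * k - 2)) + 2 * k + 1 := by
  ext n
  simp only [Finset.mem_union, Finset.mem_Icc, Finset.mem_image, mem_S]
  constructor
  · rintro ⟨_ | j, hj, c, hc, rfl⟩
    · left
      omega
    · right
      obtain ⟨c, rfl⟩ : ∃ d, c = d + 1 := ⟨c - 1, by omega⟩
      exact ⟨_, ⟨j, by omega, c, by omega, rfl⟩, recursion_map_apply hk (by omega)⟩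
  · rintro (hn | ⟨_, ⟨j, hj, c, hc, rfl⟩, rfl⟩)
    · exact ⟨0, by omega, n, by omega, by simp⟩
    · exact ⟨j + 1, by omega, c + 1, by omega, (recursion_map_apply hk (by omega)).symm⟩
end
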